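/- Let g be a root-reductive Lie algebra with Dynkin Borel subalgebra b such that the derived algebra [g,g] is infinite dimensional. Then the radical of Δ(0), i.e. the kernel of the canonical surjection Δ(0) → k onto the trivial module, is not a finitely generated U(g)-module. -/

import Mathlib

set_option linter.unusedSectionVars false

open UniversalEnvelopingAlgebra

noncomputable section

attribute [local instance 100] LieRing.ofAssociativeRing

universe u

variable (K : Type) [Field K] [IsAlgClosed K] [CharZero K]
variable (g : Type) [LieRing g] [LieAlgebra K g]

/-- The weight space of a Lie module for a weight `χ` of a subalgebra `h`. -/
def wtSpace (h : LieSubalgebra K g) (M : Type) [AddCommGroup M] [Module K M]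
    [LieRingModule g M] [LieModule K g M] (χ : Module.Dual K h) : Submodule K M where
  carrier := {m | ∀ H : h, ⁅(H : g), m⁆ = χ H • m}
  add_mem' := by intro a b ha hb H; rw [lie_add, ha H, hb H, smul_add]
  zero_mem' := by intro H; rw [lie_zero, smul_zero]
  smul_mem' := by intro c m hm H; rw [lie_smul, hm H, smul_comm]

/-- The root space of `g` relative to `h` for the functional `α`. -/
abbrev rootSp (h : LieSubalgebra K g) (α : Module.Dual K h) : Submodule K g :=
  wtSpace K g h g α

/-- Notation for the universal enveloping algebra. -/
abbrev UEA (L : Type) [LieRing L] [LieAlgebra K L] : Type :=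
  UniversalEnvelopingAlgebra K L

variable {K} in
/-- The Lie module structure on a quotient of the universal enveloping algebra
by a left ideal. -/
instance uqLRM (L : Type) [LieRing L] [LieAlgebra K L]
    (I : Submodule (UEA K L) (UEA K L)) : LieRingModule L ((UEA K L) ⧸ I) where
  bracket x m := ι K x • m
  add_lie x y m := by
    show (ι K (x + y)) • m = (ι K x) • m + (ι K y) • m
    rw [map_add, add_smul]
  lie_add x m n := by
    show (ι K x) • (m + n) = (ι K x) • m + (ι K x) • n
    rw [smul_add]
  leibniz_lie x y m := by
    show (ι K x) • ((ι K y) • m) = (ι K ⁅x, y⁆) • m + (ι K y) • ((ι K x) • m)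
    rw [LieHom.map_lie, LieRing.of_associative_ring_bracket, sub_smul, mul_smul, mul_smul,
      sub_add_cancel]

variable {K} in
instance uqLM (L : Type) [LieRing L] [LieAlgebra K L]
    (I : Submodule (UEA K L) (UEA K L)) : LieModule K L ((UEA K L) ⧸ I) where
  smul_lie c x m := by
    show (ι K (c • x)) • m = c • ((ι K x) • m)
    rw [map_smul]
    exact smul_assoc c (ι K x) m
  lie_smul c x m := by
    show (ι K x) • (c • m) = c • ((ι K x) • m)
    exact smul_comm _ _ _

/-- A root-reductive Lie algebra together with a splitting Borel subalgebra `b ⊇ h`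
containing a fixed splitting maximal toral (Cartan) subalgebra `h`.  The fields record:
an exhausting chain `gc n` of nested finite-dimensional reductive subalgebras, each
reductive in the next, with compatible Cartan subalgebras and root vectors; the root
decomposition of `g` with respect to `h` with one-dimensional root spaces; a positive
system `Φp` closed under addition and the corresponding Borel subalgebra `b = h ⊕ n⁺`;
the anti-involution `τ`; coroots and the weight `ρ`. -/
structure RootReductive where
  h : LieSubalgebra K g
  gc : ℕ → LieSubalgebra K g
  gc_mono : Monotone gc
  gc_findim : ∀ n, FiniteDimensional K (gc n)
  gc_exhausts : ∀ x : g, ∃ n, x ∈ gc n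
  gc_reductive : ∀ n, LieAlgebra.radical K (gc n) = LieAlgebra.center K (gc n)
  gc_red_in : ∀ n, ∀ N : Submodule K g, N ≤ (gc (n+1)).toSubmodule →
      (∀ x ∈ gc n, ∀ v ∈ N, ⁅x, v⁆ ∈ N) →
      ∃ N' : Submodule K g, N' ≤ (gc (n+1)).toSubmodule ∧
        (∀ x ∈ gc n, ∀ v ∈ N', ⁅x, v⁆ ∈ N') ∧
        N ⊓ N' = ⊥ ∧ N ⊔ N' = (gc (n+1)).toSubmodule
  gc_cartan : ∀ n, ∃ hc : LieSubalgebra K (gc n),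
      ((hc : Set (gc n)) = ((↑) : (gc n) → g) ⁻¹' (h : Set g)) ∧ hc.IsCartanSubalgebra
  h_exhaust : ∀ x ∈ h, ∃ n, x ∈ gc n
  Φ : Set (Module.Dual K h)
  root_iff : ∀ α, α ∈ Φ ↔ α ≠ 0 ∧ rootSp K g h α ≠ ⊥
  root_dim : ∀ α ∈ Φ, Module.rank K (rootSp K g h α) = 1
  gc_rootdec : ∀ n, (gc n).toSubmodule =
      ((gc n).toSubmodule ⊓ h.toSubmodule) ⊔
        (⨆ α ∈ Φ, ((gc n).toSubmodule ⊓ rootSp K g h α))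
  rootdec : h.toSubmodule ⊔ (⨆ α ∈ Φ, rootSp K g h α) = ⊤
  Φp : Set (Module.Dual K h)
  pos_subset : Φp ⊆ Φ
  pos_union : Φ = Φp ∪ (-Φp)
  pos_disjoint : Disjoint Φp (-Φp)
  pos_add : ∀ α ∈ Φp, ∀ β ∈ Φp, α + β ∈ Φ → α + β ∈ Φp
  b : LieSubalgebra K g
  h_le_b : h ≤ b
  b_def : b.toSubmodule = h.toSubmodule ⊔ (⨆ α ∈ Φp, rootSp K g h α)
  np : LieSubalgebra K g
  np_def : np.toSubmodule = ⨆ α ∈ Φp, rootSp K g h α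
  nm : LieSubalgebra K g
  nm_def : nm.toSubmodule = ⨆ α ∈ Φp, rootSp K g h (-α)
  τ : g →ₗ[K] g
  τ_invol : ∀ x, τ (τ x) = x
  τ_anti : ∀ x y, τ ⁅x, y⁆ = ⁅τ y, τ x⁆
  τ_h : ∀ x ∈ h, τ x = x
  τ_root : ∀ (α : Module.Dual K h), ∀ x ∈ rootSp K g h α, τ x ∈ rootSp K g h (-α)
  coroot : Module.Dual K h → h
  coroot_two : ∀ α ∈ Φ, α (coroot α) = 2
  coroot_neg : ∀ α ∈ Φ, coroot (-α) = - coroot α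
  ρ : Module.Dual K h
  ρ_simple : ∀ α ∈ Φp, (¬ ∃ β ∈ Φp, ∃ γ ∈ Φp, β + γ = α) → ρ (coroot α) = 1

namespace RootReductive

variable {K g} (S : RootReductive K g)

/-- The nilradical `n⁺` of the Borel subalgebra, as a submodule. -/
def nplus : Submodule K g := ⨆ α ∈ S.Φp, rootSp K g S.h α

/-- `Γ⁺`: the additive monoid of sums of positive roots. -/
def Γp : AddSubmonoid (Module.Dual K S.h) := AddSubmonoid.closure S.Φp

/-- The order `μ ≤ λ` iff `λ - μ ∈ Γ⁺`. -/
def wle (μ lam : Module.Dual K S.h) : Prop := lam - μ ∈ S.Γp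

/-- The set of simple (positive) roots. -/
def simples : Set (Module.Dual K S.h) :=
  {α ∈ S.Φp | ¬ ∃ β ∈ S.Φp, ∃ γ ∈ S.Φp, β + γ = α}

/-- `b` is a Dynkin Borel subalgebra: every element of `Γ⁺` is a sum of simple roots. -/
def IsDynkin : Prop := ∀ α ∈ S.Φp, α ∈ AddSubmonoid.closure S.simples

/-- The finite-rank subalgebra `g_n = g̃_n + h`. -/
def gfull (n : ℕ) : LieSubalgebra K g := S.gc n ⊔ S.h

/-- The roots `Φ_n` of `g_n`. -/
def levelRoots (n : ℕ) : Set (Module.Dual K S.h) :=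
  {α ∈ S.Φ | rootSp K g S.h α ≤ (S.gfull n).toSubmodule}

/-- The root lattice `ℤΦ_n`. -/
def zrootsLevel (n : ℕ) : AddSubgroup (Module.Dual K S.h) :=
  AddSubgroup.closure (S.levelRoots n)

/-- The root lattice `ℤΦ`. -/
def zroots : AddSubgroup (Module.Dual K S.h) := AddSubgroup.closure S.Φ

/-- The partial order `≤_n` relative to the positive roots of `g_n`. -/
def wleLevel (n : ℕ) (μ lam : Module.Dual K S.h) : Prop :=
  lam - μ ∈ AddSubmonoid.closure (S.Φp ∩ S.levelRoots n)

/-- The defining left ideal of the Verma module `Δ(λ) = U(g)/I_λ`, where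
`I_λ` is generated by `n⁺` and the elements `H - λ(H)`, `H ∈ h`. -/
def vIdeal (lam : Module.Dual K S.h) : Submodule (UEA K g) (UEA K g) :=
  Submodule.span (UEA K g)
    ({u | ∃ x ∈ S.nplus, u = ι K x} ∪
     {u | ∃ H : S.h, u = ι K (H : g) - algebraMap K (UEA K g) (lam H)})

/-- The Verma module `Δ(λ)`. -/
abbrev Verma (lam : Module.Dual K S.h) : Type := (UEA K g) ⧸ S.vIdeal lam

/-- The left ideal corresponding to the maximal submodule of `Δ(λ)`. -/
def radIdeal (lam : Module.Dual K S.h) : Submodule (UEA K g) (UEA K g) :=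
  sSup {J | S.vIdeal lam ≤ J ∧ J ≠ ⊤}

/-- The simple highest weight module `L(λ)`, the unique simple quotient of `Δ(λ)`. -/
abbrev SimpleHW (lam : Module.Dual K S.h) : Type := (UEA K g) ⧸ S.radIdeal lam

/-- The defining left ideal of the Verma module of a subalgebra `h ≤ a`, relative to the
Borel subalgebra `a ∩ b`. -/
def vIdealSub (a : LieSubalgebra K g) (ha : S.h ≤ a) (lam : Module.Dual K S.h) :
    Submodule (UEA K a) (UEA K a) :=
  Submodule.span (UEA K a)
    ({u | ∃ x : a, (x : g) ∈ S.nplus ∧ u = ι K x} ∪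
     {u | ∃ H : S.h, u = ι K (⟨(H : g), ha H.2⟩ : a) - algebraMap K (UEA K a) (lam H)})

/-- The Verma module `Δ_a(λ)` of a subalgebra `h ≤ a ≤ g`. -/
abbrev VermaSub (a : LieSubalgebra K g) (ha : S.h ≤ a) (lam : Module.Dual K S.h) : Type :=
  (UEA K a) ⧸ S.vIdealSub a ha lam

def radIdealSub (a : LieSubalgebra K g) (ha : S.h ≤ a) (lam : Module.Dual K S.h) :
    Submodule (UEA K a) (UEA K a) :=
  sSup {J | S.vIdealSub a ha lam ≤ J ∧ J ≠ ⊤}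

/-- The simple highest weight module `L_a(λ)` of a subalgebra `h ≤ a ≤ g`. -/
abbrev SimpleHWSub (a : LieSubalgebra K g) (ha : S.h ≤ a) (lam : Module.Dual K S.h) : Type :=
  (UEA K a) ⧸ S.radIdealSub a ha lam

end RootReductive

/-- The subquotient `B/(A ∩ B)` of a module attached to two submodules `A ≤ B`. -/
abbrev subquot {R M : Type} [Ring R] [AddCommGroup M] [Module R M]
    (A B : Submodule R M) : Type :=
  B ⧸ (A.comap B.subtype)

/-- The multiplicity `[M : N]` of a module `N` in a module `M`: the supremum, over all
finite filtrations of `M`, of the number of subquotients isomorphic to `N`. -/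
noncomputable def jhMult (R M N : Type) [Ring R] [AddCommGroup M] [Module R M]
    [AddCommGroup N] [Module R N] : Cardinal.{0} :=
  ⨆ (n : ℕ), ⨆ (F : Fin (n+1) →o Submodule R M),
    ⨆ (_ : F 0 = ⊥ ∧ F (Fin.last n) = ⊤),
      (Nat.card {i : Fin n //
        Nonempty ((subquot (F i.castSucc) (F i.succ)) ≃ₗ[R] N)} : Cardinal)

/-- The `K`-vector space structure on the space of `U(L)`-module homomorphisms,
via the central embedding `K → U(L)`. -/
def homKModule (L : Type) [LieRing L] [LieAlgebra K L] (M N : Type)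
    [AddCommGroup M] [Module (UEA K L) M] [AddCommGroup N] [Module (UEA K L) N] :
    Module K (M →ₗ[UEA K L] N) :=
  letI : Module K N := Module.compHom N (algebraMap K (UEA K L))
  letI : SMulCommClass (UEA K L) K N :=
    ⟨fun u c n => by
      show u • ((algebraMap K (UEA K L) c) • n) = (algebraMap K (UEA K L) c) • (u • n)
      rw [smul_smul, smul_smul, Algebra.commutes]⟩
  inferInstance

/-- The dimension over `K` of the space of `U(L)`-module homomorphisms. -/
noncomputable def homDim (L : Type) [LieRing L] [LieAlgebra K L] (M N : Type)
    [AddCommGroup M] [Module (UEA K L) M] [AddCommGroup N] [Module (UEA K L) N] :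
    Cardinal :=
  letI := homKModule K L M N
  Module.rank K (M →ₗ[UEA K L] N)

namespace RootReductive

variable {K g} (S : RootReductive K g)

/-- The weight set of weight `χ` of a `U(g)`-module. -/
def wtSet (M : Type) [AddCommGroup M] [Module (UEA K g) M]
    (χ : Module.Dual K S.h) : Set M :=
  {m | ∀ H : S.h, (ι K (H : g)) • m = (algebraMap K (UEA K g) (χ H)) • m}

/-- A `U(g)`-module is a weight module (i.e. semisimple as an `h`-module) if it is the
sum of its weight spaces. -/
def IsWeightMod (M : Type) [AddCommGroup M] [Module (UEA K g) M] : Prop :=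
  ∀ m : M, m ∈ AddSubgroup.closure (⋃ χ : Module.Dual K S.h, S.wtSet M χ)

/-- The support of a module: the set of weights whose weight space is non-zero. -/
def suppSet (M : Type) [AddCommGroup M] [Module (UEA K g) M] :
    Set (Module.Dual K S.h) :=
  {χ | ∃ m ∈ S.wtSet M χ, m ≠ 0}

/-- Local finiteness of the action of the Borel subalgebra `b`:
every vector lies in a finite-dimensional `b`-stable subspace. -/
def IsLocFin (M : Type) [AddCommGroup M] [Module (UEA K g) M] : Prop :=
  letI : Module K M := Module.compHom M (algebraMap K (UEA K g))
  ∀ m : M, ∃ N : Submodule K M, m ∈ N ∧ FiniteDimensional K N ∧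
    ∀ x ∈ S.b, ∀ v ∈ N, (ι K x) • v ∈ N

/-- The module has finite-dimensional weight spaces. -/
def HasFinDimWt (M : Type) [AddCommGroup M] [Module (UEA K g) M] : Prop :=
  letI : Module K M := Module.compHom M (algebraMap K (UEA K g))
  ∀ χ : Module.Dual K S.h, ∃ s : Finset M,
    ↑s ⊆ S.wtSet M χ ∧ S.wtSet M χ ⊆ (Submodule.span K (s : Set M) : Set M)

/-- Membership in category `O`: a weight module with locally finite `b`-action. -/
def InO (M : Type) [AddCommGroup M] [Module (UEA K g) M] : Prop :=
  S.IsWeightMod M ∧ S.IsLocFin M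

/-- A subset of `h^*` is an ideal for the order `≤`. -/
def IsIdeal (A : Set (Module.Dual K S.h)) : Prop :=
  ∀ lam ∈ A, ∀ μ, S.wle μ lam → μ ∈ A

/-- A subset of `h^*` is upper finite. -/
def UpperFinite (A : Set (Module.Dual K S.h)) : Prop :=
  ∀ μ ∈ A, {lam ∈ A | S.wle μ lam}.Finite

/-- The dot action of a linear automorphism of `h^*`: `w · λ = w(λ+ρ) - ρ`. -/
def dot (w : Module.Dual K S.h ≃ₗ[K] Module.Dual K S.h)
    (lam : Module.Dual K S.h) : Module.Dual K S.h :=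
  w (lam + S.ρ) - S.ρ

/-- The dot action of the reflection `r_α`: `r_α · λ = λ - (λ+ρ)(Hα) α`. -/
def rdot (α lam : Module.Dual K S.h) : Module.Dual K S.h :=
  lam - ((lam + S.ρ) (S.coroot α)) • α

/-- One step of the Bruhat order: `μ = r_α · λ ≤ λ` for a positive root `α`. -/
def bruhatStep (μ lam : Module.Dual K S.h) : Prop :=
  ∃ α ∈ S.Φp, μ = S.rdot α lam ∧ S.wle μ lam

/-- The Bruhat order on `h^*`. -/
def bruhat : Module.Dual K S.h → Module.Dual K S.h → Prop :=
  Relation.ReflTransGen (fun μ lam => S.bruhatStep μ lam)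

/-- The set of reflections `r_α`, `α ∈ Φ`, as linear automorphisms of `h^*`. -/
def reflSet : Set (Module.Dual K S.h ≃ₗ[K] Module.Dual K S.h) :=
  {w | ∃ α ∈ S.Φ, ∀ lam, w lam = lam - (lam (S.coroot α)) • α}

/-- The Weyl group `W`, generated by all reflections. -/
def weylGroup : Subgroup (Module.Dual K S.h ≃ₗ[K] Module.Dual K S.h) :=
  Subgroup.closure S.reflSet

/-- The integral Weyl group `W[λ]` of a weight. -/
def intWeyl (lam : Module.Dual K S.h) :
    Set (Module.Dual K S.h ≃ₗ[K] Module.Dual K S.h) :=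
  {w | w ∈ S.weylGroup ∧ S.dot w lam - lam ∈ S.zroots}

/-- The orbit `[[λ]] = W[λ] · λ`. -/
def orbit (lam : Module.Dual K S.h) : Set (Module.Dual K S.h) :=
  {μ | ∃ w ∈ S.intWeyl lam, μ = S.dot w lam}

/-- An integral weight. -/
def IsIntegral (lam : Module.Dual K S.h) : Prop :=
  ∀ w ∈ S.weylGroup, S.dot w lam - lam ∈ S.zroots

/-- A dominant weight. -/
def IsDominant (lam : Module.Dual K S.h) : Prop :=
  ∀ w ∈ S.intWeyl lam, S.wle (S.dot w lam) lam

/-- An antidominant weight. -/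
def IsAntidominant (lam : Module.Dual K S.h) : Prop :=
  ∀ w ∈ S.intWeyl lam, S.wle lam (S.dot w lam)

/-- A regular weight. -/
def IsRegular (lam : Module.Dual K S.h) : Prop :=
  ∀ w ∈ S.intWeyl lam, S.dot w lam = lam → w = 1

/-- A Verma flag with highest weights in a prescribed set. -/
def HasVermaFlagIn (A : Set (Module.Dual K S.h)) (M : Type) [AddCommGroup M]
    [Module (UEA K g) M] : Prop :=
  ∃ (n : ℕ) (F : Fin (n+1) →o Submodule (UEA K g) M), F 0 = ⊥ ∧ F (Fin.last n) = ⊤ ∧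
    ∀ i : Fin n, ∃ lam ∈ A,
      Nonempty ((subquot (F i.castSucc) (F i.succ)) ≃ₗ[UEA K g] S.Verma lam)

/-- A (finite) Verma flag. -/
def HasVermaFlag (M : Type) [AddCommGroup M] [Module (UEA K g) M] : Prop :=
  S.HasVermaFlagIn Set.univ M

end RootReductive
/-- The trivial one-dimensional `U(g)`-module `k = L(0)`. -/
def TrivMod : Type := K

instance : AddCommGroup (TrivMod K) := inferInstanceAs (AddCommGroup K)

noncomputable instance : Module (UEA K g) (TrivMod K) :=
  Module.compHom K (UniversalEnvelopingAlgebra.lift K (0 : g →ₗ⁅K⁆ K)).toRingHom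

namespace BigCell

open MvPolynomial Matrix

variable {K} {m n : Type} [Fintype m] [Fintype n] [DecidableEq m] [DecidableEq n]

theorem map_derivation_mul {R A l p q : Type*} [CommRing R] [CommRing A] [Algebra R A] [Fintype p]
    (D : Derivation R A A) (M : Matrix l p A) (N : Matrix p q A) :
    (M * N).map D = M.map D * N + M * N.map D := by
  ext i j
  simp only [Matrix.map_apply, Matrix.mul_apply, Matrix.add_apply, map_sum, Derivation.leibniz,
    smul_eq_mul, Finset.sum_add_distrib]
  rw [add_comm]
  congr 1
  exact Finset.sum_congr rfl fun _ _ => mul_comm _ _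

variable (K m n) in
/-- Polynomial functions on the big cell of a Grassmannian, with one extra variable `none` standing
for the logarithm of a section of the determinant bundle. -/
abbrev Fn : Type := MvPolynomial (Option (m × n)) K

variable (K m n) in
/-- The generic point `(1 | Z)` of the big cell. -/
def genPt : Matrix m (m ⊕ n) (Fn K m n) :=
  Matrix.fromCols 1 (Matrix.of fun i j => X (some (i, j)))

variable (m n) in
/-- A constant matrix, as a matrix of functions. -/
def con {p q : Type*} (x : Matrix p q K) : Matrix p q (Fn K m n) :=
  x.map C

theorem con_mul {p q r : Type*} [Fintype q] (x : Matrix p q K) (y : Matrix q r K) :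
    con m n (x * y) = con m n x * con m n y :=
  Matrix.map_mul

theorem con_add {p q : Type*} (x y : Matrix p q K) : con m n (x + y) = con m n x + con m n y :=
  Matrix.map_add _ (map_add C) _ _

theorem con_smul {p q : Type*} (c : K) (x : Matrix p q K) : con m n (c • x) = c • con m n x := by
  ext1 i j
  simp [con, MvPolynomial.smul_eq_C_mul]

/-- The square block of `(1 | Z) x`. -/
def sq (x : Matrix (m ⊕ n) (m ⊕ n) K) : Matrix m m (Fn K m n) :=
  (genPt K m n * con m n x).toCols₁

/-- The infinitesimal motion of the generic point under `x`. -/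
def motion (x : Matrix (m ⊕ n) (m ⊕ n) K) : Matrix m (m ⊕ n) (Fn K m n) :=
  genPt K m n * con m n x - sq x * genPt K m n

theorem motion_inl (x : Matrix (m ⊕ n) (m ⊕ n) K) (i j : m) : motion x i (Sum.inl j) = 0 := by
  have : (sq x * genPt K m n).toCols₁ = sq x := by
    rw [genPt, Matrix.mul_fromCols, Matrix.toCols₁_fromCols, Matrix.mul_one]
  have h := congrFun (congrFun this i) j
  rw [Matrix.toCols₁_apply] at h
  rw [motion, Matrix.sub_apply, h, sq, Matrix.toCols₁_apply, sub_self]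

/-- The vector field attached to a matrix. -/
def field (x : Matrix (m ⊕ n) (m ⊕ n) K) : Derivation K (Fn K m n) (Fn K m n) :=
  mkDerivation K fun v => v.elim (sq x).trace fun p => motion x p.1 (Sum.inr p.2)

theorem field_none (x : Matrix (m ⊕ n) (m ⊕ n) K) : field x (X none) = (sq x).trace :=
  mkDerivation_X K _ _

theorem map_field_genPt (x : Matrix (m ⊕ n) (m ⊕ n) K) :
    (genPt K m n).map (field x) = motion x := by
  ext1 i j
  cases j with
  | inl j =>
    rw [motion_inl, Matrix.map_apply, genPt, Matrix.fromCols_apply_inl, Matrix.one_apply]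
    split_ifs <;> simp
  | inr j =>
    rw [Matrix.map_apply, genPt, Matrix.fromCols_apply_inr]
    exact mkDerivation_X K _ _

theorem map_field_const {p q : Type*} (x : Matrix (m ⊕ n) (m ⊕ n) K) (y : Matrix p q K) :
    (con m n y).map (field x) = 0 := by
  ext1 i j
  exact derivation_C (field x : Derivation K (Fn K m n) (Fn K m n)) _

theorem map_field_genPt_mul (x y : Matrix (m ⊕ n) (m ⊕ n) K) :
    (genPt K m n * con m n y).map (field x) = motion x * con m n y := by
  rw [map_derivation_mul, map_field_genPt, map_field_const, Matrix.mul_zero, add_zero]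

theorem toCols₁_mul {p q : Type*} [Fintype p] {R : Type*} [CommRing R] (A : Matrix q p R)
    (B : Matrix p (m ⊕ n) R) : (A * B).toCols₁ = A * B.toCols₁ := by
  ext i j; simp [Matrix.mul_apply]

theorem map_field_sq (x y : Matrix (m ⊕ n) (m ⊕ n) K) :
    (sq y).map (field x) = sq (x * y) - sq x * sq y := by
  have : (sq y).map (field x) = (motion x * con m n y).toCols₁ := by
    rw [← map_field_genPt_mul]; rfl
  rw [this, motion, Matrix.sub_mul, Matrix.mul_assoc, Matrix.mul_assoc, ← con_mul,
    sq.eq_1 (x * y), sq.eq_1 y, ← toCols₁_mul]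
  rfl

theorem map_field_motion (x y : Matrix (m ⊕ n) (m ⊕ n) K) :
    (motion y).map (field x) = motion (x * y) - sq x * (genPt K m n * con m n y)
      - sq y * (genPt K m n * con m n x)
      + sq x * sq y * genPt K m n + sq y * sq x * genPt K m n := by
  have h : (motion y).map (field x) =
      (genPt K m n * con m n y).map (field x) - (sq y * genPt K m n).map (field x) := by
    ext1 i j; simp only [motion, Matrix.map_apply, Matrix.sub_apply, map_sub]
  rw [h, map_field_genPt_mul, map_derivation_mul, map_field_sq, map_field_genPt]
  simp only [motion, con_mul, Matrix.sub_mul, Matrix.mul_sub, Matrix.mul_assoc]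
  abel

theorem sq_add (x y : Matrix (m ⊕ n) (m ⊕ n) K) : sq (x + y) = sq x + sq y := by
  rw [sq, con_add, Matrix.mul_add]; rfl

theorem sq_smul (c : K) (x : Matrix (m ⊕ n) (m ⊕ n) K) : sq (c • x) = c • sq x := by
  rw [sq, con_smul, Matrix.mul_smul]; rfl

theorem motion_add (x y : Matrix (m ⊕ n) (m ⊕ n) K) : motion (x + y) = motion x + motion y := by
  rw [motion, sq_add, con_add, Matrix.mul_add, Matrix.add_mul, motion, motion]
  abel

theorem motion_smul (c : K) (x : Matrix (m ⊕ n) (m ⊕ n) K) : motion (c • x) = c • motion x := by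
  rw [motion, sq_smul, con_smul, Matrix.mul_smul, Matrix.smul_mul, motion, smul_sub]

theorem sq_sub (x y : Matrix (m ⊕ n) (m ⊕ n) K) : sq (x - y) = sq x - sq y := by
  rw [eq_sub_iff_add_eq, ← sq_add, sub_add_cancel]

theorem motion_sub (x y : Matrix (m ⊕ n) (m ⊕ n) K) : motion (x - y) = motion x - motion y := by
  rw [eq_sub_iff_add_eq, ← motion_add, sub_add_cancel]

theorem field_lie_none (x y : Matrix (m ⊕ n) (m ⊕ n) K) :
    field (x * y - y * x) (X none) = field x (field y (X none)) - field y (field x (X none)) := by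
  have key (x y : Matrix (m ⊕ n) (m ⊕ n) K) :
      field x (sq y).trace = (sq (x * y)).trace - (sq x * sq y).trace := by
    rw [← Matrix.trace_sub, ← map_field_sq, Matrix.trace, Matrix.trace, map_sum]; rfl
  rw [field_none, field_none, field_none, key, key, Matrix.trace_mul_comm (sq x), sq_sub,
    Matrix.trace_sub]
  abel

theorem field_lie_some (x y : Matrix (m ⊕ n) (m ⊕ n) K) (p : m × n) :
    field (x * y - y * x) (X (some p)) =
      field x (field y (X (some p))) - field y (field x (X (some p))) := by
  have key (x : Matrix (m ⊕ n) (m ⊕ n) K) : field x (X (some p)) = motion x p.1 (Sum.inr p.2) :=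
    mkDerivation_X K _ _
  have key2 (x y : Matrix (m ⊕ n) (m ⊕ n) K) : field x (motion y p.1 (Sum.inr p.2)) =
    ((motion y).map (field x)) p.1 (Sum.inr p.2) := rfl
  rw [key, key, key, key2, key2, map_field_motion, map_field_motion, motion_sub]
  simp only [Matrix.add_apply, Matrix.sub_apply]
  abel

variable (K m n) in
/-- The action of `𝔤𝔩` by vector fields on the functions on the big cell. -/
def act : Matrix (m ⊕ n) (m ⊕ n) K →ₗ⁅K⁆ Module.End K (Fn K m n) where
  toFun x := (field x : Fn K m n →ₗ[K] Fn K m n)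
  map_add' x y := by
    have : field (x + y) = field x + field y := by
      refine MvPolynomial.derivation_ext fun v => ?_
      cases v <;> simp [field, mkDerivation_X, sq_add, motion_add]
    rw [this]; rfl
  map_smul' c x := by
    have : field (c • x) = c • field x := by
      refine MvPolynomial.derivation_ext fun v => ?_
      cases v <;> simp [field, mkDerivation_X, sq_smul, motion_smul]
    rw [this]; rfl
  map_lie' {x y} := by
    have : field (x * y - y * x) = ⁅field x, field y⁆ := by
      refine MvPolynomial.derivation_ext fun v => ?_
      rw [Derivation.commutator_apply]
      cases v with
      | none => exact field_lie_none x y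
      | some p => exact field_lie_some x y p
    rw [LieRing.of_associative_ring_bracket, this, Derivation.commutator_coe_linear_map]

theorem act_C (x : Matrix (m ⊕ n) (m ⊕ n) K) (c : K) : act K m n x (C c) = 0 :=
  derivation_C _ _

theorem act_none (x : Matrix (m ⊕ n) (m ⊕ n) K) :
    act K m n x (X none) =
      C x.toBlocks₁₁.trace + ∑ i, ∑ j, C (x (Sum.inr j) (Sum.inl i)) * X (some (i, j)) := by
  refine (field_none x).trans ?_
  have (i : m) : sq x i i =
      C (x (Sum.inl i) (Sum.inl i)) + ∑ j, C (x (Sum.inr j) (Sum.inl i)) * X (some (i, j)) := by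
    rw [sq, Matrix.toCols₁_apply, Matrix.mul_apply]
    simp [genPt, con, Matrix.one_apply, mul_comm]
  simp [Matrix.trace, this, Finset.sum_add_distrib, Matrix.toBlocks₁₁]

theorem act_none_mem_iff (x : Matrix (m ⊕ n) (m ⊕ n) K) :
    act K m n x (X none) ∈ LinearMap.range (Algebra.linearMap K (Fn K m n)) ↔
      ∀ i j, x (Sum.inr j) (Sum.inl i) = 0 := by
  rw [act_none]
  constructor
  · rintro ⟨c, hc⟩ i j
    have := congrArg (coeff (Finsupp.single (some (i, j)) 1)) hc
    rw [Algebra.linearMap_apply, MvPolynomial.algebraMap_eq, coeff_C, coeff_add, coeff_C] at this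
    simp only [coeff_sum, coeff_C_mul, coeff_X, Finsupp.single_left_inj one_ne_zero,
      Option.some.injEq, Prod.mk.injEq] at this
    rw [if_neg, if_neg] at this
    · rw [zero_add, Finset.sum_eq_single i, Finset.sum_eq_single j] at this
      · simpa using this.symm
      all_goals simp +contextual
    all_goals
      intro h
      exact one_ne_zero (Finsupp.single_eq_zero.mp h.symm)
  · intro h
    exact ⟨x.toBlocks₁₁.trace, by simp [h, MvPolynomial.algebraMap_eq]⟩

/-- A subspace `W` of a finite-dimensional Lie algebra is detected by a vector in a module: up to a
submodule, the vector is killed exactly by the normalizer of `W`. -/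
theorem exists_rep_stabilizer (L : Type) [LieRing L] [LieAlgebra K L] [FiniteDimensional K L]
    (W : Submodule K L) :
    ∃ (R : Type) (_ : AddCommGroup R) (_ : Module K R) (ρ : L →ₗ⁅K⁆ Module.End K R) (v : R)
      (C : Submodule K R), (∀ x, ∀ r ∈ C, ρ x r ∈ C) ∧
        ∀ x, ρ x v ∈ C ↔ ∀ w ∈ W, ⁅x, w⁆ ∈ W := by
  obtain ⟨W', hW⟩ := W.exists_isCompl
  let bW := Module.finBasis K W
  let bW' := Module.finBasis K W'
  let B := (bW.prod bW').map (Submodule.prodEquivOfIsCompl W W' hW)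
  let φ : L →ₗ⁅K⁆ Matrix _ _ K :=
    ((LinearMap.toMatrixAlgEquiv B).toAlgHom : Module.End K L →ₐ[K] _).toLieHom.comp
      (LieAlgebra.ad K L)
  refine ⟨_, _, _, (act K _ _).comp φ, X none,
    LinearMap.range (Algebra.linearMap K (Fn K _ _)), ?_, fun x => ?_⟩
  · rintro x _ ⟨c, rfl⟩
    have : (act K _ _) (φ x) (Algebra.linearMap K (Fn K _ _) c) = 0 := act_C _ _
    rw [LieHom.comp_apply, this]
    exact Submodule.zero_mem _
  · rw [LieHom.comp_apply, act_none_mem_iff]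
    have hB (i) : B (Sum.inl i) = (bW i : L) := by simp [B]
    have hr (y : L) (j) : B.repr y (Sum.inr j) =
        bW'.repr ((Submodule.prodEquivOfIsCompl W W' hW).symm y).2 j := by simp [B]
    have hφ (i j) : φ x (Sum.inr j) (Sum.inl i) = B.repr ⁅x, (bW i : L)⁆ (Sum.inr j) := by
      rw [← hB]
      exact LinearMap.toMatrixAlgEquiv_apply _ _ _ _
    have hmem (y : L) : y ∈ W ↔ ∀ j, B.repr y (Sum.inr j) = 0 := by
      rw [← Submodule.prodEquivOfIsCompl_symm_apply_snd_eq_zero W W' hW]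
      simp only [hr]
      constructor
      · intro h j; rw [h]; simp
      · intro h
        apply bW'.repr.injective
        ext j; simpa using h j
    simp only [hφ]
    constructor
    · intro h w hw
      have : W ≤ W.comap (LieAlgebra.ad K L x : L →ₗ[K] L) := by
        have h1 : (⊤ : Submodule K W) ≤
            (W.comap (LieAlgebra.ad K L x : L →ₗ[K] L)).comap W.subtype := by
          rw [← bW.span_eq, Submodule.span_le]
          rintro _ ⟨i, rfl⟩
          exact (hmem _).mpr (h i)
        intro w hw
        exact h1 (x := ⟨w, hw⟩) trivial
      exact this hw
    · intro h i j
      exact (hmem _).mp (h _ (bW i).2) j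

end BigCell

section Germ

open Filter

variable {K g} (G : ℕ → LieSubalgebra K g) (R : ℕ → Type) [∀ n, AddCommGroup (R n)]
  [∀ n, Module K (R n)] (ρ : ∀ n, G n →ₗ⁅K⁆ Module.End K (R n)) (N : ∀ n, Submodule K (R n))

/-- Sequences that eventually lie in the given submodules. -/
def eventuallyIn : Submodule K (∀ n, R n) where
  carrier := {r | ∀ᶠ n in atTop, r n ∈ N n}
  add_mem' ha hb := by
    filter_upwards [ha, hb] with n h₁ h₂ using (N n).add_mem h₁ h₂
  zero_mem' := Eventually.of_forall fun n => (N n).zero_mem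
  smul_mem' c r hr := by
    filter_upwards [hr] with n h using (N n).smul_mem c h

open Classical in
/-- The termwise operator on sequences attached to an element of the ambient Lie algebra. -/
def seqOp (x : g) : Module.End K (∀ n, R n) :=
  LinearMap.pi fun n =>
    if hx : x ∈ G n then (ρ n ⟨x, hx⟩).comp (LinearMap.proj n) else 0

variable {G R ρ N}

theorem seqOp_apply {x : g} {n : ℕ} (hx : x ∈ G n) (r : ∀ n, R n) :
    seqOp G R ρ x r n = ρ n ⟨x, hx⟩ (r n) := by
  simp [seqOp, hx]

theorem eventually_mem (hm : Monotone G) (he : ∀ x, ∃ n, x ∈ G n) (x : g) :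
    ∀ᶠ n in atTop, x ∈ G n := by
  obtain ⟨n, hn⟩ := he x
  filter_upwards [eventually_ge_atTop n] with m hm' using hm hm' hn

theorem seqOp_le (hN : ∀ n x, ∀ r ∈ N n, ρ n x r ∈ N n) (x : g) :
    eventuallyIn R N ≤ (eventuallyIn R N).comap (seqOp G R ρ x) := by
  intro r hr
  have hr' : ∀ᶠ n in atTop, r n ∈ N n := hr
  show ∀ᶠ n in atTop, _ ∈ N n
  filter_upwards [hr'] with n h
  by_cases hx : x ∈ G n
  · rw [seqOp_apply hx]
    exact hN n _ _ h
  · simp [seqOp, hx]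

theorem mk_eq_mk_of_eventually {r s : ∀ n, R n} (h : ∀ᶠ n in atTop, r n = s n) :
    (eventuallyIn R N).mkQ r = (eventuallyIn R N).mkQ s := by
  rw [Submodule.mkQ_apply, Submodule.mkQ_apply, Submodule.Quotient.eq]
  show ∀ᶠ n in atTop, _ ∈ N n
  filter_upwards [h] with n hn
  simp [hn]

/-- The action of a directed union of Lie algebras on germs of sequences in modules over the terms
of the union. -/
def germRep (hm : Monotone G) (he : ∀ x, ∃ n, x ∈ G n)
    (hN : ∀ n x, ∀ r ∈ N n, ρ n x r ∈ N n) :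
    g →ₗ⁅K⁆ Module.End K ((∀ n, R n) ⧸ eventuallyIn R N) where
  toFun x := (eventuallyIn R N).mapQ _ (seqOp G R ρ x) (seqOp_le hN x)
  map_add' x y := by
    refine Submodule.linearMap_qext _ (LinearMap.ext fun r => mk_eq_mk_of_eventually ?_)
    filter_upwards [eventually_mem hm he x, eventually_mem hm he y] with n hx hy
    rw [seqOp_apply ((G n).add_mem hx hy), Pi.add_apply, seqOp_apply hx, seqOp_apply hy,
      ← LinearMap.add_apply, ← map_add]
    rfl
  map_smul' c x := by
    refine Submodule.linearMap_qext _ (LinearMap.ext fun r => mk_eq_mk_of_eventually ?_)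
    filter_upwards [eventually_mem hm he x] with n hx
    rw [seqOp_apply ((G n).smul_mem c hx), RingHom.id_apply, Pi.smul_apply, seqOp_apply hx,
      ← LinearMap.smul_apply, ← map_smul]
    rfl
  map_lie' {x y} := by
    refine Submodule.linearMap_qext _ (LinearMap.ext fun r => mk_eq_mk_of_eventually
      (s := seqOp G R ρ x (seqOp G R ρ y r) - seqOp G R ρ y (seqOp G R ρ x r)) ?_)
    filter_upwards [eventually_mem hm he x, eventually_mem hm he y] with n hx hy
    rw [seqOp_apply ((G n).lie_mem hx hy), Pi.sub_apply, seqOp_apply hx, seqOp_apply hy,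
      seqOp_apply hy, seqOp_apply hx]
    have : (⟨⁅x, y⁆, (G n).lie_mem hx hy⟩ : G n) = ⁅(⟨x, hx⟩ : G n), (⟨y, hy⟩ : G n)⁆ := rfl
    rw [this, LieHom.map_lie, LieRing.of_associative_ring_bracket]
    rfl

/-- If `f` lies in the left ideal of `U(g)` generated by a set `P` whose elements eventually kill
the vectors `v n` modulo `N n`, then so does `f`. -/
theorem eventually_mem_of_mem_span (hm : Monotone G) (he : ∀ x, ∃ n, x ∈ G n)
    (hN : ∀ n x, ∀ r ∈ N n, ρ n x r ∈ N n) (v : ∀ n, R n) {P : Set g}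
    (hP : ∀ x ∈ P, ∀ᶠ n in atTop, ∀ hx : x ∈ G n, ρ n ⟨x, hx⟩ (v n) ∈ N n) {f : g}
    (hf : ι K f ∈ Submodule.span (UEA K g) (ι K '' P)) :
    ∀ᶠ n in atTop, ∀ hx : f ∈ G n, ρ n ⟨f, hx⟩ (v n) ∈ N n := by
  let Ψ := UniversalEnvelopingAlgebra.lift K (germRep hm he hN)
  let w := (eventuallyIn R N).mkQ v
  have key (x : g) : Ψ (ι K x) w = 0 ↔ ∀ᶠ n in atTop, ∀ hx : x ∈ G n, ρ n ⟨x, hx⟩ (v n) ∈ N n := by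
    rw [UniversalEnvelopingAlgebra.lift_ι_apply]
    show (eventuallyIn R N).mkQ (seqOp G R ρ x v) = 0 ↔ _
    rw [Submodule.mkQ_apply, Submodule.Quotient.mk_eq_zero]
    show (∀ᶠ n in atTop, _ ∈ N n) ↔ _
    refine eventually_congr ?_
    filter_upwards [eventually_mem hm he x] with n hx
    rw [seqOp_apply hx]
    exact ⟨fun h _ => h, fun h => h hx⟩
  have hall : ∀ u ∈ Submodule.span (UEA K g) (ι K '' P), Ψ u w = 0 := by
    intro u hu
    induction hu using Submodule.span_induction with
    | mem u hu =>
      obtain ⟨x, hx, rfl⟩ := hu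
      exact (key x).mpr (hP x hx)
    | zero => simp
    | add a b _ _ ha hb => rw [map_add, LinearMap.add_apply, ha, hb, add_zero]
    | smul a b _ hb => rw [smul_eq_mul, map_mul, Module.End.mul_apply, hb, map_zero]
  exact (key f).mp (hall _ hf)

end Germ

/-- For a subalgebra `p` of a directed union of finite-dimensional Lie algebras, every element of
`g` in the left ideal `U(g) p` eventually normalizes `p` in the terms of the union. -/
theorem eventually_normalizes_of_mem_span {K g : Type} [Field K] [IsAlgClosed K] [CharZero K]
    [LieRing g] [LieAlgebra K g] {G : ℕ → LieSubalgebra K g}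
    (hm : Monotone G) (he : ∀ x, ∃ n, x ∈ G n) (hfd : ∀ n, FiniteDimensional K (G n))
    (p : LieSubalgebra K g) {f : g}
    (hf : ι K f ∈ Submodule.span (UEA K g) (ι K '' (p : Set g))) :
    ∀ᶠ n in Filter.atTop, f ∈ G n → ∀ y ∈ G n, y ∈ p → ⁅f, y⁆ ∈ p := by
  choose R i₁ i₂ ρ v C hC hstab using fun n =>
    BigCell.exists_rep_stabilizer (K := K) (G n) (p.toSubmodule.comap (G n).subtype)
  have := eventually_mem_of_mem_span (R := R) (ρ := ρ) (N := C) hm he (fun n x r hr => hC n x r hr)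
    v (P := p) (fun x hx => Filter.Eventually.of_forall fun n hxn => (hstab n _).mpr
      fun w hw => p.lie_mem hx hw) hf
  filter_upwards [this] with n hn hfn y hy hyp
  exact (hstab n _).mp (hn hfn) ⟨y, hy⟩ hyp

namespace RootReductive

variable {K g} (S : RootReductive K g)

theorem lie_eq_zero_of_mem_h {x y : g} (hx : x ∈ S.h) (hy : y ∈ S.h) : ⁅x, y⁆ = 0 := by
  have h₁ := S.τ_anti x y
  rw [S.τ_h _ (S.h.lie_mem hx hy), S.τ_h _ hx, S.τ_h _ hy, ← lie_skew, neg_eq_iff_add_eq_zero,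
    ← two_smul K] at h₁
  rw [← lie_skew, neg_eq_zero]
  exact (smul_eq_zero.mp h₁).resolve_left two_ne_zero

variable {S}

theorem lie_mem_rootSp {χ ψ : Module.Dual K S.h} {x y : g} (hx : x ∈ rootSp K g S.h χ)
    (hy : y ∈ rootSp K g S.h ψ) : ⁅x, y⁆ ∈ rootSp K g S.h (χ + ψ) := by
  intro H
  rw [leibniz_lie, hx H, hy H, smul_lie, lie_smul, LinearMap.add_apply, add_smul]

variable (S) in
theorem rootSp_zero : rootSp K g S.h 0 = S.h.toSubmodule := by
  ext x
  constructor
  · intro hx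
    obtain ⟨n, hn⟩ := S.gc_exhausts x
    obtain ⟨hc, hc₁, hc₂⟩ := S.gc_cartan n
    have key (y : S.gc n) : y ∈ hc ↔ (y : g) ∈ S.h := by
      have := Set.ext_iff.mp hc₁ y
      simpa using this
    have : (⟨x, hn⟩ : S.gc n) ∈ hc := by
      rw [← hc₂.self_normalizing, LieSubalgebra.mem_normalizer_iff]
      intro y hy
      have h₁ := hx ⟨y, (key y).mp hy⟩
      rw [LinearMap.zero_apply, zero_smul] at h₁
      rw [key, LieSubalgebra.coe_bracket, ← lie_skew, h₁, neg_zero]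
      exact S.h.zero_mem
    exact (key _).mp this
  · intro hx H
    rw [S.lie_eq_zero_of_mem_h H.2 hx, LinearMap.zero_apply, zero_smul]

theorem mem_rootSp_zero {x : g} : x ∈ rootSp K g S.h 0 ↔ x ∈ S.h := by
  rw [rootSp_zero]; rfl

theorem lie_mem_h {χ : Module.Dual K S.h} {x y : g} (hx : x ∈ rootSp K g S.h χ)
    (hy : y ∈ rootSp K g S.h (-χ)) : ⁅x, y⁆ ∈ S.h := by
  have := lie_mem_rootSp hx hy
  rwa [add_neg_cancel, mem_rootSp_zero] at this

theorem eq_zero_or_mem_of_ne_zero {χ : Module.Dual K S.h} {x : g} (hx : x ∈ rootSp K g S.h χ)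
    (h0 : x ≠ 0) : χ = 0 ∨ χ ∈ S.Φ := by
  by_cases hχ : χ = 0
  · exact Or.inl hχ
  · refine Or.inr ((S.root_iff χ).mpr ⟨hχ, fun h => h0 ?_⟩)
    rwa [h, Submodule.mem_bot] at hx

theorem exists_ne_zero {α : Module.Dual K S.h} (hα : α ∈ S.Φ) :
    ∃ x ∈ rootSp K g S.h α, x ≠ 0 :=
  Submodule.exists_mem_ne_zero_of_ne_bot ((S.root_iff α).mp hα).2

theorem neg_mem {α : Module.Dual K S.h} (hα : α ∈ S.Φ) : -α ∈ S.Φ := by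
  rw [S.pos_union] at hα ⊢
  rcases hα with h | h
  · exact Or.inr (by simpa using h)
  · exact Or.inl h

variable (S) in
theorem exists_weight_basis (n : ℕ) : ∃ (m : ℕ) (v : Module.Basis (Fin m) K (S.gc n))
    (χ : Fin m → Module.Dual K S.h), ∀ i, (v i : g) ∈ rootSp K g S.h (χ i) := by
  have := S.gc_findim n
  let s : Set (S.gc n) := {x | ∃ χ, (x : g) ∈ rootSp K g S.h χ}
  have hs : ⊤ ≤ Submodule.span K s := by
    have h₁ : (S.gc n).toSubmodule ≤ (Submodule.span K s).map (S.gc n).toSubmodule.subtype := by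
      conv_lhs => rw [S.gc_rootdec n]
      have (χ : Module.Dual K S.h) : (S.gc n).toSubmodule ⊓ rootSp K g S.h χ ≤
          (Submodule.span K s).map (S.gc n).toSubmodule.subtype := fun x hx =>
        ⟨⟨x, hx.1⟩, Submodule.subset_span ⟨χ, hx.2⟩, rfl⟩
      refine sup_le ?_ (iSup₂_le fun α _ => this α)
      rw [← S.rootSp_zero]
      exact this 0
    rintro x -
    obtain ⟨y, hy, hxy⟩ := h₁ x.2
    rwa [← Subtype.ext hxy]
  let b := Module.Basis.ofSpan hs
  have : Fintype _ := FiniteDimensional.fintypeBasisIndex b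
  let v := b.reindex (Fintype.equivFin _)
  have hv (i) : ∃ χ, (v i : g) ∈ rootSp K g S.h χ := by
    have := Module.Basis.ofSpan_subset hs ⟨(Fintype.equivFin _).symm i, rfl⟩
    simpa [v, b, s] using this
  choose χ hχ using hv
  exact ⟨_, v, χ, hχ⟩

section WeightBasis

variable {n m : ℕ} {v : Module.Basis (Fin m) K (S.gc n)} {χ : Fin m → Module.Dual K S.h}
  (hv : ∀ i, (v i : g) ∈ rootSp K g S.h (χ i))

include hv

theorem repr_eq_zero {ψ : Module.Dual K S.h} {x : S.gc n} (hx : (x : g) ∈ rootSp K g S.h ψ)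
    {i : Fin m} (hi : χ i ≠ ψ) : v.repr x i = 0 := by
  by_contra hne
  refine hi (LinearMap.ext fun H => ?_)
  have hli : LinearIndependent K fun i => (v i : g) :=
    v.linearIndependent.map' (S.gc n).toSubmodule.subtype (Submodule.ker_subtype _)
  have hx' : (x : g) = ∑ j, v.repr x j • (v j : g) := by
    have := congrArg (S.gc n).toSubmodule.subtype (v.sum_repr x).symm
    rwa [map_sum] at this
  have h₁ : ∑ j, (v.repr x j * (χ j H - ψ H)) • (v j : g) = 0 := by
    have h₂ := hx H
    rw [hx', lie_sum, Finset.smul_sum, ← sub_eq_zero, ← Finset.sum_sub_distrib] at h₂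
    rw [← h₂]
    refine Finset.sum_congr rfl fun j _ => ?_
    rw [lie_smul, hv j H, smul_smul, smul_smul, ← sub_smul]
    ring_nf
  have := Fintype.linearIndependent_iff.mp hli _ h₁ i
  exact sub_eq_zero.mp ((mul_eq_zero.mp this).resolve_left hne)

theorem exists_eq_of_ne_zero {ψ : Module.Dual K S.h} {x : g} (hx : x ∈ rootSp K g S.h ψ)
    (hn : x ∈ S.gc n) (h0 : x ≠ 0) : ∃ i, χ i = ψ := by
  by_contra! h
  refine h0 ?_
  have : v.repr ⟨x, hn⟩ = 0 := Finsupp.ext fun i => repr_eq_zero hv (x := ⟨x, hn⟩) hx (h i)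
  rw [LinearEquiv.map_eq_zero_iff] at this
  exact congrArg Subtype.val this

theorem killingForm_eq (x y : S.gc n) :
    killingForm K (S.gc n) x y = ∑ i, v.repr ⁅x, ⁅y, v i⁆⁆ i := by
  classical
  rw [killingForm, LieModule.traceForm_apply_apply, LinearMap.trace_eq_matrix_trace K v]
  simp [Matrix.trace, LinearMap.toMatrix_apply]

theorem killingForm_eq_zero {α β : Module.Dual K S.h} {x y : S.gc n}
    (hx : (x : g) ∈ rootSp K g S.h α) (hy : (y : g) ∈ rootSp K g S.h β) (h : α + β ≠ 0) :
    killingForm K (S.gc n) x y = 0 := by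
  rw [killingForm_eq hv]
  refine Finset.sum_eq_zero fun i _ =>
    repr_eq_zero hv (ψ := α + (β + χ i)) (lie_mem_rootSp hx (lie_mem_rootSp hy (hv i))) fun h' => ?_
  rw [← add_assoc, eq_comm, add_eq_right] at h'
  exact h h'

theorem killingForm_h {x y : g} (hx : x ∈ S.h) (hy : y ∈ S.h) (hxn : x ∈ S.gc n)
    (hyn : y ∈ S.gc n) :
    killingForm K (S.gc n) ⟨x, hxn⟩ ⟨y, hyn⟩ = ∑ i, χ i ⟨x, hx⟩ * χ i ⟨y, hy⟩ := by
  rw [killingForm_eq hv]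
  refine Finset.sum_congr rfl fun i _ => ?_
  have h₁ : ⁅(⟨x, hxn⟩ : S.gc n), ⁅(⟨y, hyn⟩ : S.gc n), v i⁆⁆ =
      (χ i ⟨x, hx⟩ * χ i ⟨y, hy⟩) • v i := by
    apply Subtype.ext
    have h₂ := hv i ⟨y, hy⟩
    have h₃ := hv i ⟨x, hx⟩
    show ⁅x, ⁅y, (v i : g)⁆⁆ = (χ i ⟨x, hx⟩ * χ i ⟨y, hy⟩) • (v i : g)
    rw [h₂, lie_smul, h₃, smul_smul, mul_comm]
  rw [h₁]
  simp

theorem killingForm_lie {α : Module.Dual K S.h} {e f y : g}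
    (hf : f ∈ rootSp K g S.h (-α)) (hy : y ∈ S.h) (hen : e ∈ S.gc n) (hfn : f ∈ S.gc n)
    (hyn : y ∈ S.gc n) :
    killingForm K (S.gc n) ⟨⁅e, f⁆, (S.gc n).lie_mem hen hfn⟩ ⟨y, hyn⟩ =
      α ⟨y, hy⟩ * killingForm K (S.gc n) ⟨e, hen⟩ ⟨f, hfn⟩ := by
  have h₁ : (⟨⁅e, f⁆, (S.gc n).lie_mem hen hfn⟩ : S.gc n) = ⁅(⟨e, hen⟩ : S.gc n), ⟨f, hfn⟩⁆ := rfl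
  have h₂ : ⁅(⟨f, hfn⟩ : S.gc n), (⟨y, hyn⟩ : S.gc n)⁆ = α ⟨y, hy⟩ • ⟨f, hfn⟩ := by
    apply Subtype.ext
    have := hf ⟨y, hy⟩
    show ⁅f, y⁆ = α ⟨y, hy⟩ • f
    rw [← lie_skew, this, LinearMap.neg_apply, neg_smul, neg_neg]
  rw [h₁, killingForm, LieModule.traceForm_apply_lie_apply, h₂, map_smul, smul_eq_mul]

end WeightBasis

theorem ad_pow_mem_rootSp {α γ : Module.Dual K S.h} {a x : g} (ha : a ∈ rootSp K g S.h α)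
    (hx : x ∈ rootSp K g S.h γ) (k : ℕ) :
    ((LieAlgebra.ad K g a) ^ k) x ∈ rootSp K g S.h (k • α + γ) := by
  induction k with
  | zero => simpa using hx
  | succ k ih =>
    rw [pow_succ', Module.End.mul_apply, LieAlgebra.ad_apply, succ_nsmul', add_assoc]
    exact lie_mem_rootSp ha ih

theorem exists_common_level (T : Finset g) : ∃ n, ∀ x ∈ T, x ∈ S.gc n := by
  have : ∀ᶠ n in Filter.atTop, ∀ x ∈ T, x ∈ S.gc n :=
    (Filter.eventually_all_finset T).mpr fun x _ => eventually_mem S.gc_mono S.gc_exhausts x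
  exact this.exists

theorem exists_ad_pow_eq_zero {α γ : Module.Dual K S.h} (hα : α ≠ 0) {a x : g}
    (ha : a ∈ rootSp K g S.h α) (hx : x ∈ rootSp K g S.h γ) :
    ∃ k : ℕ, ((LieAlgebra.ad K g a) ^ k) x = 0 := by
  classical
  by_contra! hne
  obtain ⟨n, hn⟩ := exists_common_level (S := S) {a, x}
  obtain ⟨m, v, χ, hv⟩ := S.exists_weight_basis n
  have hmem (k : ℕ) : ((LieAlgebra.ad K g a) ^ k) x ∈ S.gc n := by
    induction k with
    | zero => exact hn x (by simp)
    | succ k ih =>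
      rw [pow_succ', Module.End.mul_apply, LieAlgebra.ad_apply]
      exact (S.gc n).lie_mem (hn a (by simp)) ih
  choose i hi using fun k : ℕ =>
    exists_eq_of_ne_zero hv (ad_pow_mem_rootSp ha hx k) (hmem k) (hne k)
  refine not_injective_infinite_finite i fun k l hkl => ?_
  have h₁ : k • α + γ = l • α + γ := by rw [← hi, ← hi, hkl]
  rw [add_left_inj, ← Nat.cast_smul_eq_nsmul K, ← Nat.cast_smul_eq_nsmul K] at h₁
  exact_mod_cast smul_left_injective K hα h₁

theorem exists_highest {α γ : Module.Dual K S.h} (hα : α ≠ 0) {a x : g}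
    (ha : a ∈ rootSp K g S.h α) (hx : x ∈ rootSp K g S.h γ) (h0 : x ≠ 0) :
    ∃ k : ℕ, ((LieAlgebra.ad K g a) ^ k) x ≠ 0 ∧ ⁅a, ((LieAlgebra.ad K g a) ^ k) x⁆ = 0 ∧
      ∀ l ≤ k, ((LieAlgebra.ad K g a) ^ l) x ≠ 0 := by
  classical
  have h := exists_ad_pow_eq_zero hα ha hx
  have h₁ : Nat.find h ≠ 0 := fun h' => h0 (by simpa [h'] using Nat.find_spec h)
  obtain ⟨k, hk⟩ := Nat.exists_eq_succ_of_ne_zero h₁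
  refine ⟨k, Nat.find_min h (by omega), ?_, fun l hl => Nat.find_min h (by omega)⟩
  rw [← LieAlgebra.ad_apply K g, ← Module.End.mul_apply, ← pow_succ', ← Nat.succ_eq_add_one, ← hk]
  exact Nat.find_spec h

/-- The weight of a vector killed by a raising operator is half a natural multiple of the root,
when evaluated at the commutator of the raising and the lowering operator. -/
theorem exists_two_mul_eq {α γ : Module.Dual K S.h} (hα : α ≠ 0) {e f x : g}
    (he : e ∈ rootSp K g S.h α) (hf : f ∈ rootSp K g S.h (-α)) (hx : x ∈ rootSp K g S.h γ)
    (h0 : x ≠ 0) (hex : ⁅e, x⁆ = 0) :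
    ∃ j : ℕ, 2 * γ ⟨⁅e, f⁆, lie_mem_h he hf⟩ = j * α ⟨⁅e, f⁆, lie_mem_h he hf⟩ := by
  obtain ⟨j, hj, hj', -⟩ := exists_highest (neg_ne_zero.mpr hα) hf hx h0
  set t : S.h := ⟨⁅e, f⁆, lie_mem_h he hf⟩ with ht
  have key (l : ℕ) : (2 : K) • ⁅e, ((LieAlgebra.ad K g f) ^ (l + 1)) x⁆ =
      ((l + 1 : K) * (2 * γ t - l * α t)) • ((LieAlgebra.ad K g f) ^ l) x := by
    have hstep (l : ℕ) : ⁅e, ((LieAlgebra.ad K g f) ^ (l + 1)) x⁆ =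
        (γ t - l * α t) • ((LieAlgebra.ad K g f) ^ l) x +
          ⁅f, ⁅e, ((LieAlgebra.ad K g f) ^ l) x⁆⁆ := by
      rw [pow_succ', Module.End.mul_apply, LieAlgebra.ad_apply, leibniz_lie]
      congr 1
      have := ad_pow_mem_rootSp hf hx l t
      rw [show ⁅e, f⁆ = (t : g) from rfl, this]
      congr 1
      simp
      ring
    induction l with
    | zero =>
      rw [hstep]
      simp [hex, smul_smul]
    | succ l ih =>
      rw [hstep (l + 1), smul_add, ← lie_smul, ih, lie_smul, ← LieAlgebra.ad_apply K g f,
        ← Module.End.mul_apply, ← pow_succ', smul_smul, ← add_smul]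
      congr 1
      push_cast
      ring
  have h₁ := key j
  rw [pow_succ', Module.End.mul_apply, LieAlgebra.ad_apply, hj', lie_zero, smul_zero, eq_comm,
    smul_eq_zero, or_iff_left hj, mul_eq_zero, or_iff_right (by exact_mod_cast j.succ_ne_zero)]
    at h₁
  exact ⟨j, sub_eq_zero.mp h₁⟩

/-- The values of weights at commutators of opposite root vectors. -/
theorem exists_string {α γ : Module.Dual K S.h} (hα : α ≠ 0) {e f x : g}
    (he : e ∈ rootSp K g S.h α) (hf : f ∈ rootSp K g S.h (-α)) (hx : x ∈ rootSp K g S.h γ)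
    (h0 : x ≠ 0) : ∃ j k : ℕ,
      2 * γ ⟨⁅e, f⁆, lie_mem_h he hf⟩ = (j - 2 * k) * α ⟨⁅e, f⁆, lie_mem_h he hf⟩ ∧
      (k ≠ 0 → γ + α = 0 ∨ γ + α ∈ S.Φ) := by
  obtain ⟨k, hk, hk', hk''⟩ := exists_highest hα he hx h0
  obtain ⟨j, hj⟩ := exists_two_mul_eq hα he hf (ad_pow_mem_rootSp he hx k) hk hk'
  refine ⟨j, k, ?_, fun hk0 => ?_⟩
  · simp only [LinearMap.add_apply, LinearMap.smul_apply, nsmul_eq_mul] at hj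
    linear_combination hj
  · have h₁ := ad_pow_mem_rootSp he hx 1
    rw [one_nsmul, add_comm] at h₁
    exact eq_zero_or_mem_of_ne_zero h₁ (hk'' 1 (Nat.one_le_iff_ne_zero.mpr hk0))

/-- `t` is a coroot of `α`, realized as a commutator of root vectors. -/
def IsCoroot (α : Module.Dual K S.h) (t : S.h) : Prop :=
  α t = 2 ∧ ∃ e ∈ rootSp K g S.h α, ∃ f ∈ rootSp K g S.h (-α), ⁅e, f⁆ = (t : g)

theorem exists_isCoroot {α : Module.Dual K S.h} (hα : α ∈ S.Φ) : ∃ t, IsCoroot α t := by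
  classical
  have hα0 := ((S.root_iff α).mp hα).1
  obtain ⟨e, he, he0⟩ := exists_ne_zero hα
  obtain ⟨H₀, hH₀⟩ : ∃ H, α H ≠ 0 := by
    by_contra! h
    exact hα0 (LinearMap.ext h)
  obtain ⟨n, hn⟩ := exists_common_level (S := S) {e, (H₀ : g)}
  have hen := hn e (by simp)
  have hHn := hn H₀ (by simp)
  have := S.gc_findim n
  obtain ⟨m, v, χ, hv⟩ := S.exists_weight_basis n
  have h₁ : (⟨e, hen⟩ : S.gc n) ∉ LieIdeal.killingCompl K (S.gc n) ⊤ := by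
    intro h
    have h₂ := LieAlgebra.killingCompl_top_le_radical K (S.gc n) h
    rw [S.gc_reductive n, LieModule.mem_maxTrivSubmodule] at h₂
    have h₃ := congrArg Subtype.val (h₂ ⟨H₀, hHn⟩)
    have h₄ := he H₀
    simp only [LieSubalgebra.coe_bracket, ZeroMemClass.coe_zero] at h₃
    rw [h₃, eq_comm, smul_eq_zero] at h₄
    exact h₄.elim hH₀ he0
  obtain ⟨i, hi⟩ : ∃ i, killingForm K (S.gc n) ⟨e, hen⟩ (v i) ≠ 0 := by
    by_contra! h
    have h₂ : killingForm K (S.gc n) ⟨e, hen⟩ = 0 := v.ext h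
    refine h₁ ((LieIdeal.mem_killingCompl K (S.gc n) ⊤).mpr fun y _ => ?_)
    rw [killingForm, LieModule.traceForm_comm]
    exact LinearMap.congr_fun h₂ y
  have hχ : χ i = -α := by
    by_contra h
    refine hi (killingForm_eq_zero hv he (hv i) fun h' => h ?_)
    rw [eq_neg_iff_add_eq_zero, add_comm, h']
  have hf : (v i : g) ∈ rootSp K g S.h (-α) := hχ ▸ hv i
  set t : S.h := ⟨⁅e, (v i : g)⁆, lie_mem_h he hf⟩ with ht
  have hκ := killingForm_lie hv hf H₀.2 hen (v i).2 hHn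
  rw [killingForm_h hv t.2 H₀.2] at hκ
  have ht0 : α t ≠ 0 := by
    intro h0
    refine mul_ne_zero hH₀ hi (hκ.symm.trans (Finset.sum_eq_zero fun j _ => ?_))
    obtain ⟨a, b, hab, -⟩ := exists_string hα0 he hf (hv j)
      (fun h => v.ne_zero j (Subtype.ext h))
    rw [← ht, h0, mul_zero, mul_eq_zero, or_iff_right two_ne_zero] at hab
    exact mul_eq_zero_of_left hab _
  refine ⟨(2 / α t) • t, ?_, e, he, (2 / α t) • (v i : g), Submodule.smul_mem _ _ hf, ?_⟩
  · rw [map_smul, smul_eq_mul, div_mul_cancel₀ _ ht0]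
  · rw [lie_smul]; rfl

end RootReductive

namespace RootReductive

variable {K g} {S : RootReductive K g}

theorem IsCoroot.exists_int {α γ : Module.Dual K S.h} {t : S.h} (ht : IsCoroot α t)
    (hγ : γ ∈ S.Φ) : ∃ p : ℤ, γ t = p ∧ (p < 0 → γ + α = 0 ∨ γ + α ∈ S.Φ) ∧
      (0 < p → γ - α = 0 ∨ γ - α ∈ S.Φ) := by
  obtain ⟨h2, e, he, f, hf, hef⟩ := ht
  have hα : α ≠ 0 := by
    rintro rfl
    simp at h2
  obtain ⟨x, hx, hx0⟩ := exists_ne_zero hγ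
  have hf' : e ∈ rootSp K g S.h (-(-α)) := by rwa [neg_neg]
  have ht₁ : (⟨⁅e, f⁆, lie_mem_h he hf⟩ : S.h) = t := Subtype.ext hef
  have ht₂ : (⟨⁅f, e⁆, lie_mem_h hf hf'⟩ : S.h) = -t :=
    Subtype.ext (show ⁅f, e⁆ = -(t : g) by rw [← hef, lie_skew])
  obtain ⟨j, k, hjk, hk⟩ := exists_string hα he hf hx hx0
  obtain ⟨j', k', hjk', hk'⟩ := exists_string (neg_ne_zero.mpr hα) hf hf' hx hx0
  rw [ht₁, h2, mul_comm] at hjk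
  rw [ht₂, map_neg, map_neg, LinearMap.neg_apply, neg_neg, h2, mul_comm] at hjk'
  have h₁ : γ t = ((j - 2 * k : ℤ) : K) := by
    push_cast
    exact mul_right_cancel₀ two_ne_zero hjk
  have h₂ : γ t = ((-(j' - 2 * k') : ℤ) : K) := by
    push_cast
    refine neg_injective (mul_right_cancel₀ two_ne_zero (hjk'.trans ?_))
    ring
  have h₃ : (j - 2 * k : ℤ) = -(j' - 2 * k') := by exact_mod_cast h₁.symm.trans h₂
  refine ⟨j - 2 * k, h₁, fun h => hk (by omega), fun h => ?_⟩
  rw [sub_eq_add_neg]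
  exact hk' (by omega)

open Classical in
variable (S) in
/-- A coroot of each root that is a commutator of root vectors. -/
def corootVec (α : Module.Dual K S.h) : S.h :=
  if hα : α ∈ S.Φ then (exists_isCoroot hα).choose else 0

theorem isCoroot_corootVec {α : Module.Dual K S.h} (hα : α ∈ S.Φ) :
    IsCoroot α (S.corootVec α) := by
  rw [corootVec, dif_pos hα]
  exact (exists_isCoroot hα).choose_spec

open Classical in
variable (S) in
/-- The integral pairing of a root with the coroot of another root. -/
def cartanInt (γ α : Module.Dual K S.h) : ℤ :=
  if h : ∃ p : ℤ, γ (S.corootVec α) = p then h.choose else 0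

theorem cast_cartanInt {γ α : Module.Dual K S.h} (hγ : γ ∈ S.Φ) (hα : α ∈ S.Φ) :
    (S.cartanInt γ α : K) = γ (S.corootVec α) := by
  obtain ⟨p, hp, -⟩ := (isCoroot_corootVec hα).exists_int hγ
  have h : ∃ p : ℤ, γ (S.corootVec α) = p := ⟨p, hp⟩
  rw [cartanInt, dif_pos h]
  exact h.choose_spec.symm

theorem cartanInt_self {α : Module.Dual K S.h} (hα : α ∈ S.Φ) : S.cartanInt α α = 2 := by
  have h := cast_cartanInt hα hα
  rw [(isCoroot_corootVec hα).1] at h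
  exact_mod_cast h

theorem add_mem_of_cartanInt_neg {γ α : Module.Dual K S.h} (hγ : γ ∈ S.Φ) (hα : α ∈ S.Φ)
    (h : S.cartanInt γ α < 0) : γ + α = 0 ∨ γ + α ∈ S.Φ := by
  obtain ⟨p, hp, hp', -⟩ := (isCoroot_corootVec hα).exists_int hγ
  rw [← cast_cartanInt hγ hα, Int.cast_inj] at hp
  exact hp' (hp ▸ h)

theorem sub_mem_of_cartanInt_pos {γ α : Module.Dual K S.h} (hγ : γ ∈ S.Φ) (hα : α ∈ S.Φ)
    (h : 0 < S.cartanInt γ α) : γ - α = 0 ∨ γ - α ∈ S.Φ := by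
  obtain ⟨p, hp, -, hp'⟩ := (isCoroot_corootVec hα).exists_int hγ
  rw [← cast_cartanInt hγ hα, Int.cast_inj] at hp
  exact hp' (hp ▸ h)

/-- Over a finite set of roots, the coroots are represented, up to positive scalars, by integral
vectors whose dot products are given by the pairing. -/
theorem exists_form (T : Finset (Module.Dual K S.h)) (hT : ∀ α ∈ T, α ∈ S.Φ) (y : S.h) :
    ∃ (m : ℕ) (u : Module.Dual K S.h → Fin m → ℤ) (d : Module.Dual K S.h → ℚ) (w : Fin m → K),
      (∀ α ∈ T, 0 < d α) ∧
      (∀ α ∈ T, ∀ β ∈ T, ∑ i, (u α i : ℚ) * u β i = d α * S.cartanInt α β) ∧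
      ∀ α ∈ T, ∑ i, (u α i : K) * w i = d α * α y := by
  classical
  choose! e he f hf hef using fun α (hα : α ∈ S.Φ) => (isCoroot_corootVec hα).2
  obtain ⟨n, hn⟩ := exists_common_level (S := S) (T.image e ∪ T.image f ∪ {(y : g)})
  obtain ⟨m, v, χ, hv⟩ := S.exists_weight_basis n
  have hen : ∀ α ∈ T, e α ∈ S.gc n := fun α hα =>
    hn _ (Finset.mem_union_left _ (Finset.mem_union_left _ (Finset.mem_image_of_mem e hα)))
  have hfn : ∀ α ∈ T, f α ∈ S.gc n := fun α hα =>
    hn _ (Finset.mem_union_left _ (Finset.mem_union_right _ (Finset.mem_image_of_mem f hα)))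
  have hyn : (y : g) ∈ S.gc n := hn _ (by simp)
  have hHn : ∀ α ∈ T, (S.corootVec α : g) ∈ S.gc n := fun α hα => by
    rw [← hef α (hT α hα)]
    exact (S.gc n).lie_mem (hen α hα) (hfn α hα)
  have key : ∀ α ∈ T, ∃ k : K, ∀ x : S.h, (x : g) ∈ S.gc n →
      ∑ i, χ i (S.corootVec α) * χ i x = k * α x := fun α hα =>
    ⟨killingForm K (S.gc n) ⟨e α, hen α hα⟩ ⟨f α, hfn α hα⟩, fun x hx => by
      have h₁ := killingForm_lie hv (hf α (hT α hα)) x.2 (hen α hα) (hfn α hα) hx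
      simp only [hef α (hT α hα)] at h₁
      rw [killingForm_h hv (S.corootVec α).2 x.2] at h₁
      rw [mul_comm, ← h₁]⟩
  have hu : ∀ α ∈ T, ∀ i, ∃ p : ℤ, χ i (S.corootVec α) = p := fun α hα i => by
    rcases eq_zero_or_mem_of_ne_zero (hv i) (fun h => v.ne_zero i (Subtype.ext h)) with h | h
    · exact ⟨0, by rw [h]; simp⟩
    · exact ⟨_, (cast_cartanInt h (hT α hα)).symm⟩
  choose! u hu using hu
  have hd : ∀ α ∈ T, ∀ x : S.h, (x : g) ∈ S.gc n →
      ∑ i, (u α i : K) * χ i x = (((∑ i, (u α i : ℚ) * u α i) / 2 : ℚ) : K) * α x := by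
    intro α hα x hx
    obtain ⟨k, hk⟩ := key α hα
    have h₁ := hk _ (hHn α hα)
    rw [(isCoroot_corootVec (hT α hα)).1] at h₁
    have h₂ := hk x hx
    simp only [hu α hα] at h₁ h₂
    rw [h₂]
    push_cast
    rw [h₁, mul_div_cancel_right₀ _ two_ne_zero]
  refine ⟨m, u, fun α => (∑ i, (u α i : ℚ) * u α i) / 2, fun i => χ i y, fun α hα => ?_,
    fun α hα β hβ => ?_, fun α hα => hd α hα y hyn⟩
  · refine div_pos ?_ two_pos
    have he0 : e α ≠ 0 := by
      intro h0
      have h₁ := hef α (hT α hα)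
      rw [h0, zero_lie] at h₁
      have h₂ := (isCoroot_corootVec (hT α hα)).1
      rw [show S.corootVec α = 0 from Subtype.ext h₁.symm, map_zero] at h₂
      exact two_ne_zero h₂.symm
    obtain ⟨i, hi⟩ := exists_eq_of_ne_zero hv (he α (hT α hα)) (hen α hα) he0
    refine Finset.sum_pos' (fun i _ => mul_self_nonneg _) ⟨i, Finset.mem_univ i, ?_⟩
    have h₁ := hu α hα i
    rw [hi, (isCoroot_corootVec (hT α hα)).1] at h₁
    have h₂ : u α i = 2 := by exact_mod_cast h₁.symm
    rw [h₂]
    norm_num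
  · have h₁ := hd α hα _ (hHn β hβ)
    rw [← cast_cartanInt (hT α hα) (hT β hβ)] at h₁
    simp only [hu β hβ] at h₁
    exact_mod_cast h₁

theorem sum_smul_eq_zero {T : Finset (Module.Dual K S.h)} (hT : ∀ α ∈ T, α ∈ S.Φ)
    (c : Module.Dual K S.h → ℚ)
    (hc : ∀ β ∈ T, c β * ∑ α ∈ T, c α * S.cartanInt α β ≤ 0) :
    ∑ α ∈ T, (c α : K) • α = 0 := by
  refine LinearMap.ext fun y => ?_
  obtain ⟨m, u, d, w, hd, hu, hw⟩ := exists_form T hT y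
  let z : Fin m → ℚ := fun i => ∑ α ∈ T, c α / d α * u α i
  have h₁ : ∑ i, z i * z i = ∑ β ∈ T, (d β)⁻¹ * (c β * ∑ α ∈ T, c α * S.cartanInt α β) := by
    have h₂ : ∀ β ∈ T, (d β)⁻¹ * (c β * ∑ α ∈ T, c α * S.cartanInt α β) =
        ∑ α ∈ T, ∑ i, (c α / d α * u α i) * (c β / d β * u β i) := by
      intro β hβ
      rw [Finset.mul_sum, Finset.mul_sum]
      refine Finset.sum_congr rfl fun α hα => ?_
      have h₃ : ∑ i, (c α / d α * u α i) * (c β / d β * u β i) =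
          c α / d α * (c β / d β) * ∑ i, (u α i : ℚ) * u β i := by
        rw [Finset.mul_sum]
        exact Finset.sum_congr rfl fun i _ => by ring
      rw [h₃, hu α hα β hβ]
      have := (hd α hα).ne'
      have := (hd β hβ).ne'
      field_simp
    calc ∑ i, z i * z i = ∑ i, ∑ β ∈ T, z i * (c β / d β * u β i) :=
          Finset.sum_congr rfl fun i _ => Finset.mul_sum _ _ _
      _ = ∑ β ∈ T, ∑ i, z i * (c β / d β * u β i) := Finset.sum_comm
      _ = ∑ β ∈ T, ∑ i, ∑ α ∈ T, (c α / d α * u α i) * (c β / d β * u β i) :=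
          Finset.sum_congr rfl fun β _ => Finset.sum_congr rfl fun i _ => Finset.sum_mul _ _ _
      _ = _ := Finset.sum_congr rfl fun β hβ => Finset.sum_comm.trans (h₂ β hβ).symm
  have hz : ∀ i, z i = 0 := by
    have h₂ : ∑ i, z i * z i = 0 := by
      refine le_antisymm ?_ (Finset.sum_nonneg fun i _ => mul_self_nonneg _)
      rw [h₁]
      exact Finset.sum_nonpos fun β hβ =>
        mul_nonpos_of_nonneg_of_nonpos (inv_nonneg.mpr (hd β hβ).le) (hc β hβ)
    intro i
    exact mul_self_eq_zero.mp
      ((Finset.sum_eq_zero_iff_of_nonneg fun i _ => mul_self_nonneg _).mp h₂ i (Finset.mem_univ i))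
  have h₂ : ∑ i, (z i : K) * w i = ∑ α ∈ T, (c α : K) * α y := by
    simp only [z, Rat.cast_sum, Finset.sum_mul]
    rw [Finset.sum_comm]
    refine Finset.sum_congr rfl fun α hα => ?_
    have h₃ : ∑ i, ((c α / d α * u α i : ℚ) : K) * w i =
        (c α / d α : ℚ) * ∑ i, (u α i : K) * w i := by
      rw [Finset.mul_sum]
      refine Finset.sum_congr rfl fun i _ => ?_
      push_cast
      ring
    rw [h₃, hw α hα, ← mul_assoc, ← Rat.cast_mul, div_mul_cancel₀ _ (hd α hα).ne']
  simpa [hz] using h₂.symm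

theorem cartanInt_abs_le {α γ : Module.Dual K S.h} (hα : α ∈ S.Φ) (hγ : γ ∈ S.Φ) :
    |S.cartanInt γ α| ≤ 4 := by
  classical
  obtain ⟨m, u, d, w, hd, hu, -⟩ := exists_form (S := S) {α, γ} (by simp [hα, hγ]) 0
  have hαT : α ∈ ({α, γ} : Finset (Module.Dual K S.h)) := by simp
  have hγT : γ ∈ ({α, γ} : Finset (Module.Dual K S.h)) := by simp
  have h₁ := hu α hαT γ hγT
  have h₂ := hu γ hγT α hαT
  have h₃ := hu α hαT α hαT
  have h₄ := hu γ hγT γ hγT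
  rw [cartanInt_self hα] at h₃
  rw [cartanInt_self hγ] at h₄
  have h₅ : d α * S.cartanInt α γ = d γ * S.cartanInt γ α := by
    rw [← h₁, ← h₂]
    exact Finset.sum_congr rfl fun i _ => mul_comm _ _
  have hdα := hd α hαT
  have hdγ := hd γ hγT
  have h₆ := Finset.sum_mul_sq_le_sq_mul_sq Finset.univ (fun i => (u γ i : ℚ)) fun i => (u α i : ℚ)
  simp only [sq, h₂] at h₆
  rw [h₃, h₄] at h₆
  have h₇ : (S.cartanInt α γ * S.cartanInt γ α : ℚ) ≤ 4 := by
    have : d α * d γ * (S.cartanInt α γ * S.cartanInt γ α) ≤ d α * d γ * 4 := by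
      push_cast at h₆
      calc _ = d γ * S.cartanInt γ α * (d α * S.cartanInt α γ) := by ring
        _ = d γ * S.cartanInt γ α * (d γ * S.cartanInt γ α) := by rw [h₅]
        _ ≤ _ := h₆
        _ = _ := by ring
    exact le_of_mul_le_mul_left this (mul_pos hdα hdγ)
  by_cases h0 : S.cartanInt γ α = 0
  · rw [h0]; norm_num
  have h₈ : 0 < S.cartanInt α γ * S.cartanInt γ α := by
    have : (0 : ℚ) < d α * (S.cartanInt α γ * S.cartanInt γ α) := by
      rw [← mul_assoc, h₅, mul_assoc]
      exact mul_pos hdγ (mul_self_pos.mpr (by exact_mod_cast h0))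
    have := pos_of_mul_pos_right this hdα.le
    exact_mod_cast this
  have h₉ : S.cartanInt α γ * S.cartanInt γ α ≤ 4 := by exact_mod_cast h₇
  have hle : |S.cartanInt γ α| ≤ |S.cartanInt α γ * S.cartanInt γ α| := by
    rw [abs_mul]
    refine le_mul_of_one_le_left (abs_nonneg _) (Int.one_le_abs ?_)
    intro h
    simp [h] at h₈
  rw [abs_of_pos h₈] at hle
  exact hle.trans h₉

theorem add_ne_zero_of_pos {α β : Module.Dual K S.h} (hα : α ∈ S.Φp) (hβ : β ∈ S.Φp) :
    α + β ≠ 0 := fun h =>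
  Set.disjoint_left.mp S.pos_disjoint hα
    (by rw [Set.mem_neg, ← eq_neg_of_add_eq_zero_right h]; exact hβ)

/-- A nonempty sum of positive roots is nonzero. -/
theorem multiset_sum_ne_zero (s : Multiset (Module.Dual K S.h)) (hs : ∀ α ∈ s, α ∈ S.Φp)
    (h0 : s ≠ 0) : s.sum ≠ 0 := by
  classical
  induction hn : s.card using Nat.strong_induction_on generalizing s with
  | _ n ih =>
    obtain ⟨β, hβs⟩ := Multiset.exists_mem_of_ne_zero h0
    obtain ⟨t, rfl⟩ := Multiset.exists_cons_of_mem hβs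
    intro hsum
    have hβ := hs β hβs
    have hβΦ := S.pos_subset hβ
    obtain ⟨γ, hγt, hγ⟩ : ∃ γ ∈ t, S.cartanInt γ β < 0 := by
      by_contra! h
      have h₁ : ((((β ::ₘ t).map fun γ => S.cartanInt γ β).sum : ℤ) : K) = 0 := by
        have h₂ : (β ::ₘ t).map (fun γ => (S.cartanInt γ β : K)) =
            (β ::ₘ t).map (fun γ => γ (S.corootVec β)) :=
          Multiset.map_congr rfl fun γ hγ => cast_cartanInt (S.pos_subset (hs γ hγ)) hβΦ
        have h₄ := map_multiset_sum (LinearMap.applyₗ (S.corootVec β) :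
          Module.Dual K S.h →ₗ[K] K) (β ::ₘ t)
        simp only [LinearMap.applyₗ_apply_apply] at h₄
        rw [Int.cast_multiset_sum, Multiset.map_map]
        simp only [Function.comp_def]
        rw [h₂, ← h₄, hsum, LinearMap.zero_apply]
      have h₂ : 0 ≤ (t.map fun γ => S.cartanInt γ β).sum :=
        Multiset.sum_nonneg (by simpa using h)
      rw [Int.cast_eq_zero, Multiset.map_cons, Multiset.sum_cons, cartanInt_self hβΦ] at h₁
      omega
    obtain ⟨t', rfl⟩ := Multiset.exists_cons_of_mem hγt
    have hγp : γ ∈ S.Φp := hs γ (by simp)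
    have hmem := S.pos_add γ hγp β hβ ((add_mem_of_cartanInt_neg (S.pos_subset hγp) hβΦ
      hγ).resolve_left (add_ne_zero_of_pos hγp hβ))
    refine ih _ ?_ ((γ + β) ::ₘ t') (fun δ hδ => ?_) (Multiset.cons_ne_zero) rfl ?_
    · rw [← hn]; simp
    · rcases Multiset.mem_cons.mp hδ with rfl | h
      · exact hmem
      · exact hs δ (by simp [h])
    · rw [← hsum]
      simp only [Multiset.sum_cons]
      abel

theorem cartanInt_nonpos {σ σ' : Module.Dual K S.h} (hσ : σ ∈ S.simples) (hσ' : σ' ∈ S.simples)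
    (hne : σ ≠ σ') : S.cartanInt σ σ' ≤ 0 := by
  by_contra! h
  rcases sub_mem_of_cartanInt_pos (S.pos_subset hσ.1) (S.pos_subset hσ'.1) h with h | h
  · exact hne (sub_eq_zero.mp h)
  · rw [S.pos_union] at h
    rcases h with h | h
    · exact hσ.2 ⟨_, h, _, hσ'.1, sub_add_cancel _ _⟩
    · rw [Set.mem_neg, neg_sub] at h
      exact hσ'.2 ⟨_, h, _, hσ.1, sub_add_cancel _ _⟩

theorem mem_of_add_sum_eq {σ : Module.Dual K S.h} (hσ : σ ∈ S.simples)
    {s t : Multiset (Module.Dual K S.h)} (hs : ∀ α ∈ s, α ∈ S.simples)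
    (ht : ∀ α ∈ t, α ∈ S.simples) (h : σ + t.sum = s.sum) : σ ∈ s := by
  classical
  by_contra hσs
  set t' := σ ::ₘ t with ht'
  have ht'' : ∀ α ∈ t', α ∈ S.simples := by
    intro α hα
    rcases Multiset.mem_cons.mp hα with rfl | h
    exacts [hσ, ht _ h]
  have hsum : (s - t').sum = (t' - s).sum := by
    have h₁ : (s - t').sum + t'.sum = (t' - s).sum + s.sum := by
      rw [← Multiset.sum_add, ← Multiset.sum_add, ← Multiset.union_def, ← Multiset.union_def,
        Multiset.union_comm]
    rw [ht', Multiset.sum_cons, h] at h₁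
    exact add_right_cancel h₁
  have hB : t' - s ≠ 0 := by
    intro h0
    have : Multiset.count σ (t' - s) = 0 := by simp [h0]
    rw [Multiset.count_sub, Multiset.count_eq_zero_of_notMem hσs, ht', Multiset.count_cons_self]
      at this
    omega
  have hBs : ∀ α ∈ t' - s, α ∈ S.simples := fun α hα =>
    ht'' α (Multiset.mem_of_le (Multiset.sub_le_self _ _) hα)
  have hAs : ∀ α ∈ s - t', α ∈ S.simples := fun α hα =>
    hs α (Multiset.mem_of_le (Multiset.sub_le_self _ _) hα)
  refine multiset_sum_ne_zero (t' - s) (fun α hα => (hBs α hα).1) hB ?_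
  rw [← hsum]
  set T := (s - t').toFinset ∪ (t' - s).toFinset
  have hT : ∀ α ∈ T, α ∈ S.simples := by
    intro α hα
    rcases Finset.mem_union.mp hα with h | h
    · exact hAs α (Multiset.mem_toFinset.mp h)
    · exact hBs α (Multiset.mem_toFinset.mp h)
  have hA : (s - t').sum = ∑ α ∈ T, ((((s - t').count α : ℕ) : ℚ) : K) • α := by
    rw [Finset.sum_multiset_count_of_subset _ T Finset.subset_union_left]
    simp [Nat.cast_smul_eq_nsmul]
  have hB' : (t' - s).sum = ∑ α ∈ T, ((((t' - s).count α : ℕ) : ℚ) : K) • α := by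
    rw [Finset.sum_multiset_count_of_subset _ T Finset.subset_union_right]
    simp [Nat.cast_smul_eq_nsmul]
  rw [hA]
  refine sum_smul_eq_zero (fun α hα => S.pos_subset (hT α hα).1) _ fun β hβ => ?_
  have hAB : ∑ α ∈ T, ((s - t').count α : ℚ) * S.cartanInt α β =
      ∑ α ∈ T, ((t' - s).count α : ℚ) * S.cartanInt α β := by
    have h₁ := congrArg (fun l : Module.Dual K S.h => l (S.corootVec β))
      (hA.symm.trans (hsum.trans hB'))
    simp only [LinearMap.sum_apply, LinearMap.smul_apply, smul_eq_mul] at h₁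
    have h₂ (a : Module.Dual K S.h → ℕ) : ∑ α ∈ T, ((a α : ℚ) : K) * α (S.corootVec β) =
        ((∑ α ∈ T, (a α : ℚ) * S.cartanInt α β : ℚ) : K) := by
      rw [Rat.cast_sum]
      refine Finset.sum_congr rfl fun α hα => ?_
      rw [← cast_cartanInt (S.pos_subset (hT α hα).1) (S.pos_subset (hT β hβ).1)]
      push_cast
      rfl
    rw [h₂, h₂] at h₁
    exact Rat.cast_injective h₁
  rw [hAB, Finset.mul_sum]
  refine Finset.sum_nonpos fun α hα => ?_
  by_cases hαβ : α = β
  · subst hαβ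
    have : (s - t').count α = 0 ∨ (t' - s).count α = 0 := by
      rw [Multiset.count_sub, Multiset.count_sub]
      omega
    rcases this with h | h <;> simp [h]
  · have h₁ : (S.cartanInt α β : ℚ) ≤ 0 := by
      exact_mod_cast cartanInt_nonpos (hT α hα) (hT β hβ) hαβ
    exact mul_nonpos_of_nonneg_of_nonpos (Nat.cast_nonneg _)
      (mul_nonpos_of_nonneg_of_nonpos (Nat.cast_nonneg _) h₁)

theorem finite_roots_of_finite_simples (hD : S.IsDynkin) (hfin : S.simples.Finite) :
    S.Φ.Finite := by
  classical
  obtain ⟨T, hT⟩ := hfin.exists_finset_coe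
  have hTΦ : ∀ α ∈ T, α ∈ S.Φ := fun α hα =>
    S.pos_subset (show α ∈ S.simples from hT ▸ hα).1
  have hspan : ∀ γ ∈ S.Φ, γ ∈ Submodule.span ℤ (T : Set (Module.Dual K S.h)) := by
    have hp : ∀ γ ∈ S.Φp, γ ∈ Submodule.span ℤ (T : Set (Module.Dual K S.h)) := by
      intro γ hγ
      have h₁ : AddSubmonoid.closure S.simples ≤
          (Submodule.span ℤ (T : Set (Module.Dual K S.h))).toAddSubmonoid := by
        rw [AddSubmonoid.closure_le, ← hT]
        exact Submodule.subset_span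
      exact h₁ (hD γ hγ)
    intro γ hγ
    rw [S.pos_union] at hγ
    rcases hγ with h | h
    · exact hp γ h
    · exact (Submodule.neg_mem_iff _).mp (hp _ h)
  let F : Module.Dual K S.h → (T → ℤ) := fun γ α => S.cartanInt γ α
  refine Set.Finite.of_finite_image (f := F)
    ((Set.finite_Icc (fun _ => -4) (fun _ => 4)).subset ?_) ?_
  · rintro _ ⟨γ, hγ, rfl⟩
    exact ⟨fun α => (abs_le.mp (cartanInt_abs_le (hTΦ α α.2) hγ)).1,
      fun α => (abs_le.mp (cartanInt_abs_le (hTΦ α α.2) hγ)).2⟩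
  · intro γ hγ γ' hγ' hF
    obtain ⟨c, -, hc⟩ := Submodule.mem_span_finset.mp
      (Submodule.sub_mem _ (hspan γ hγ) (hspan γ' hγ'))
    have hc' : ∑ α ∈ T, (((c α : ℤ) : ℚ) : K) • α = γ - γ' := by
      rw [← hc]
      exact Finset.sum_congr rfl fun α _ => by
        rw [Rat.cast_intCast]
        exact Int.cast_smul_eq_zsmul K (c α) α
    rw [← sub_eq_zero, ← hc']
    refine sum_smul_eq_zero hTΦ _ fun β hβ => ?_
    have h₁ := congrArg (fun l : Module.Dual K S.h => l (S.corootVec β)) hc'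
    have h₂ : S.cartanInt γ β = S.cartanInt γ' β := congrFun hF ⟨β, hβ⟩
    have h₃ : ((∑ α ∈ T, ((c α : ℤ) : ℚ) * S.cartanInt α β : ℚ) : K) = 0 := by
      simp only [LinearMap.sum_apply, LinearMap.smul_apply, smul_eq_mul, LinearMap.sub_apply] at h₁
      rw [← cast_cartanInt hγ (hTΦ β hβ), ← cast_cartanInt hγ' (hTΦ β hβ), h₂, sub_self] at h₁
      rw [← h₁, Rat.cast_sum]
      refine Finset.sum_congr rfl fun α hα => ?_
      rw [← cast_cartanInt (hTΦ α hα) (hTΦ β hβ)]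
      push_cast
      rfl
    rw [Rat.cast_eq_zero.mp h₃, mul_zero]

theorem finite_roots (hD : S.IsDynkin) (F : Finset (Module.Dual K S.h)) (hF : ∀ α ∈ F, α ∈ S.Φp)
    (h : ∀ δ ∈ S.Φp, -δ ∈ AddSubmonoid.closure (S.Φp ∪ {α | -α ∈ F})) : S.Φ.Finite := by
  classical
  choose! m hm₁ hm₂ using fun α (hα : α ∈ F) =>
    AddSubmonoid.exists_multiset_of_mem_closure (hD α (hF α hα))
  have hle : AddSubmonoid.closure S.Φp ≤ AddSubmonoid.closure S.simples :=
    (AddSubmonoid.closure_le).mpr hD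
  refine finite_roots_of_finite_simples hD
    ((F.biUnion fun α => (m α).toFinset).finite_toSet.subset fun σ hσ => ?_)
  have h₁ := h σ hσ.1
  rw [AddSubmonoid.closure_union, AddSubmonoid.mem_sup] at h₁
  obtain ⟨a, ha, b, hb, hab⟩ := h₁
  obtain ⟨t, ht, rfl⟩ := AddSubmonoid.exists_multiset_of_mem_closure (hle ha)
  have h₂ : ∃ s : Multiset (Module.Dual K S.h),
      (∀ α ∈ s, α ∈ S.simples ∧ ∃ β ∈ F, α ∈ m β) ∧ s.sum = -b := by
    clear hab
    induction hb using AddSubmonoid.closure_induction with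
    | mem x hx => exact ⟨m (-x), fun α hα => ⟨hm₁ _ hx α hα, _, hx, hα⟩, hm₂ _ hx⟩
    | zero => exact ⟨0, by simp, by simp⟩
    | add x y _ _ hx hy =>
      obtain ⟨s, hs, hsx⟩ := hx
      obtain ⟨s', hs', hsy⟩ := hy
      refine ⟨s + s', fun α hα => (Multiset.mem_add.mp hα).elim (hs α) (hs' α), ?_⟩
      rw [Multiset.sum_add, hsx, hsy, neg_add]
  obtain ⟨s, hs, hsb⟩ := h₂
  have h₃ := mem_of_add_sum_eq hσ (fun α hα => (hs α hα).1) ht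
    (by
      rw [hsb]
      exact eq_neg_of_add_eq_zero_left (by rw [add_assoc, hab, add_neg_cancel]))
  obtain ⟨β, hβ, hβ'⟩ := (hs σ h₃).2
  simpa using ⟨β, hβ, hβ'⟩

end RootReductive

theorem UniversalEnvelopingAlgebra.mem_of_forall_mem_of_subalgebra {R L : Type*} [CommRing R]
    [LieRing L] [LieAlgebra R L] (A : Subalgebra R (UniversalEnvelopingAlgebra R L))
    (hA : ∀ x : L, ι R x ∈ A) (u : UniversalEnvelopingAlgebra R L) : u ∈ A := by
  let φ : L →ₗ⁅R⁆ A :=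
    { toFun := fun x => ⟨ι R x, hA x⟩
      map_add' := fun x y => Subtype.ext (map_add (ι R) x y)
      map_smul' := fun c x => Subtype.ext (map_smul (ι R) c x)
      map_lie' := fun {x y} => Subtype.ext (LieHom.map_lie (ι R) x y) }
  have h : A.val.comp (lift R φ) = AlgHom.id R _ := by
    apply UniversalEnvelopingAlgebra.hom_ext
    ext1 x
    show ((lift R φ (ι R x) : A) : UniversalEnvelopingAlgebra R L) = ι R x
    rw [lift_ι_apply]
    rfl
  have := AlgHom.congr_fun h u
  rw [AlgHom.comp_apply, AlgHom.id_apply] at this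
  rw [← this]
  exact (lift R φ u).2

namespace RootReductive

variable {K g} (S : RootReductive K g)

/-- The subalgebra of `g` spanned by the weight spaces with weights in an additive monoid. -/
def weightSubalgebra (Q : AddSubmonoid (Module.Dual K S.h)) : LieSubalgebra K g where
  toSubmodule := Submodule.span K {x | ∃ q ∈ Q, x ∈ rootSp K g S.h q}
  lie_mem' {x y} hx hy := by
    refine Submodule.span_induction₂ (p := fun x y _ _ => ⁅x, y⁆ ∈
      Submodule.span K {x | ∃ q ∈ Q, x ∈ rootSp K g S.h q}) ?_ ?_ ?_ ?_ ?_ ?_ ?_ hx hy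
    · rintro x y ⟨q, hq, hx⟩ ⟨r, hr, hy⟩
      exact Submodule.subset_span ⟨_, Q.add_mem hq hr, lie_mem_rootSp hx hy⟩
    · intro y _
      rw [zero_lie]
      exact Submodule.zero_mem _
    · intro x _
      rw [lie_zero]
      exact Submodule.zero_mem _
    · intro x y z _ _ _ h₁ h₂
      rw [add_lie]
      exact Submodule.add_mem _ h₁ h₂
    · intro x y z _ _ _ h₁ h₂
      rw [lie_add]
      exact Submodule.add_mem _ h₁ h₂
    · intro r x y _ _ h
      rw [smul_lie]
      exact Submodule.smul_mem _ _ h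
    · intro r x y _ _ h
      rw [lie_smul]
      exact Submodule.smul_mem _ _ h

variable {S}

theorem mem_weightSubalgebra {Q : AddSubmonoid (Module.Dual K S.h)} {q : Module.Dual K S.h}
    (hq : q ∈ Q) {x : g} (hx : x ∈ rootSp K g S.h q) : x ∈ S.weightSubalgebra Q :=
  Submodule.subset_span ⟨q, hq, hx⟩

theorem mem_of_mem_weightSubalgebra {Q : AddSubmonoid (Module.Dual K S.h)}
    {ψ : Module.Dual K S.h} {f : g} (hf : f ∈ rootSp K g S.h ψ) (hf0 : f ≠ 0)
    (h : f ∈ S.weightSubalgebra Q) : ψ ∈ Q := by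
  by_contra hψ
  have : IsLieAbelian S.h := ⟨fun x y => Subtype.ext (S.lie_eq_zero_of_mem_h x.2 y.2)⟩
  have hle (χ : Module.Dual K S.h) {x : g} (hx : x ∈ rootSp K g S.h χ) :
      x ∈ LieModule.genWeightSpace g (χ : S.h → K) :=
    LieModule.weightSpace_le_genWeightSpace g _ ((LieModule.mem_weightSpace _ _).mpr hx)
  have hind := LieModule.iSupIndep_genWeightSpace K S.h g ψ
  rw [disjoint_iff] at hind
  have h₁ : Submodule.span K {x | ∃ q ∈ Q, x ∈ rootSp K g S.h q} ≤
      (⨆ χ, ⨆ (_ : χ ≠ (ψ : S.h → K)), LieModule.genWeightSpace g χ :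
        LieSubmodule K S.h g).toSubmodule := by
    rw [Submodule.span_le]
    rintro x ⟨q, hq, hx⟩
    have hne : (q : S.h → K) ≠ ψ := fun h => hψ (DFunLike.coe_injective h ▸ hq)
    exact LieSubmodule.mem_iSup_of_mem _ (LieSubmodule.mem_iSup_of_mem hne (hle q hx))
  have h₂ := (LieSubmodule.mem_inf _ _ _).mpr ⟨hle ψ hf, h₁ h⟩
  rw [hind] at h₂
  exact hf0 ((LieSubmodule.mem_bot _).mp h₂)

theorem finiteDimensional_derived (h : S.Φ.Finite) :
    FiniteDimensional K (LieAlgebra.derivedSeries K g 1) := by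
  obtain ⟨T, hT⟩ := h.exists_finset_coe
  set V : Submodule K g := ⨆ α ∈ S.Φ, rootSp K g S.h α with hV
  have hVfg : V.FG := by
    have h₁ : V = ⨆ α ∈ T, rootSp K g S.h α := by
      rw [hV, ← hT]
      rfl
    rw [h₁]
    refine Submodule.fg_biSup _ _ fun α hα => ?_
    have := Module.finite_of_rank_eq_one (S.root_dim α (hT ▸ hα))
    exact Module.Finite.iff_fg.mp this
  have hhV : ∀ x ∈ S.h, ∀ y ∈ V, ⁅x, y⁆ ∈ V := by
    intro x hx y hy
    have h₁ : V ≤ V.comap (LieAlgebra.ad K g x) := by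
      refine iSup₂_le fun α hα y hy => ?_
      rw [Submodule.mem_comap, LieAlgebra.ad_apply, hy ⟨x, hx⟩]
      exact V.smul_mem _ (Submodule.mem_iSup_of_mem α (Submodule.mem_iSup_of_mem hα hy))
    exact h₁ hy
  let B : g →ₗ[K] g →ₗ[K] g := (LieAlgebra.ad K g : g →ₗ[K] Module.End K g)
  have hle : (LieAlgebra.derivedSeries K g 1).toSubmodule ≤ V ⊔ Submodule.map₂ B V V := by
    rw [LieAlgebra.derivedSeries_def, LieAlgebra.derivedSeriesOfIdeal_succ,
      LieAlgebra.derivedSeriesOfIdeal_zero, LieSubmodule.lieIdeal_oper_eq_linear_span',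
      Submodule.span_le]
    rintro _ ⟨x, -, y, -, rfl⟩
    have htop (z : g) : ∃ a ∈ S.h, ∃ b ∈ V, a + b = z := by
      have : z ∈ S.h.toSubmodule ⊔ V := by
        rw [hV, S.rootdec]
        trivial
      exact Submodule.mem_sup.mp this
    obtain ⟨a, ha, b, hb, rfl⟩ := htop x
    obtain ⟨a', ha', b', hb', rfl⟩ := htop y
    have h₁ : ⁅a + b, a' + b'⁆ = (⁅a, b'⁆ - ⁅a', b⁆) + ⁅b, b'⁆ := by
      rw [add_lie, lie_add, lie_add, S.lie_eq_zero_of_mem_h ha ha', ← lie_skew a' b]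
      abel
    rw [SetLike.mem_coe, h₁]
    exact Submodule.add_mem_sup (V.sub_mem (hhV a ha b' hb') (hhV a' ha' b hb))
      (Submodule.apply_mem_map₂ B hb hb')
  have hfg : (V ⊔ Submodule.map₂ B V V).FG := hVfg.sup (hVfg.map₂ B hVfg)
  have := Module.Finite.iff_fg.mpr hfg
  exact Submodule.finiteDimensional_of_le hle

variable (S) in
/-- The images in the Verma module of highest weight `0` of the negative root vectors. -/
def negRootVectors : Set (S.Verma 0) :=
  {m | ∃ α ∈ S.Φp, ∃ x ∈ rootSp K g S.h (-α), m = (S.vIdeal 0).mkQ (ι K x)}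

theorem mkQ_ι_mem_span (x : g) :
    (S.vIdeal 0).mkQ (ι K x) ∈ Submodule.span (UEA K g) S.negRootVectors := by
  let W : Submodule K g :=
    { carrier := {x | (S.vIdeal 0).mkQ (ι K x) ∈ Submodule.span (UEA K g) S.negRootVectors}
      add_mem' := fun {a b} ha hb => by
        rw [Set.mem_ofPred_eq, map_add, map_add]
        exact Submodule.add_mem _ ha hb
      zero_mem' := by
        rw [Set.mem_ofPred_eq, map_zero, map_zero]
        exact Submodule.zero_mem _
      smul_mem' := fun c a ha => by
        rw [Set.mem_ofPred_eq, map_smul, Algebra.smul_def, ← smul_eq_mul, map_smul]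
        exact Submodule.smul_mem _ _ ha }
  have hzero {x : g} (hx : ι K x ∈ S.vIdeal 0) : x ∈ W := by
    show (S.vIdeal 0).mkQ (ι K x) ∈ Submodule.span (UEA K g) S.negRootVectors
    rw [Submodule.mkQ_apply, (Submodule.Quotient.mk_eq_zero _).mpr hx]
    exact Submodule.zero_mem _
  have hW : ⊤ ≤ W := by
    rw [← S.rootdec]
    refine sup_le (fun x hx => hzero (Submodule.subset_span (Or.inr ⟨⟨x, hx⟩, ?_⟩)))
      (iSup₂_le fun α hα x hx => ?_)
    · simp
    · rw [S.pos_union] at hα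
      rcases hα with h | h
      · exact hzero (Submodule.subset_span (Or.inl ⟨x, Submodule.mem_iSup_of_mem α
          (Submodule.mem_iSup_of_mem h hx), rfl⟩))
      · exact Submodule.subset_span ⟨-α, h, x, by rwa [neg_neg], rfl⟩
  exact hW (Submodule.mem_top (x := x))

/-- The augmentation of the universal enveloping algebra. -/
def augmentation (K g : Type) [Field K] [LieRing g] [LieAlgebra K g] : UEA K g →ₐ[K] K :=
  lift K (0 : g →ₗ⁅K⁆ K)

theorem mkQ_sub_mem_span (u : UEA K g) :
    (S.vIdeal 0).mkQ (u - algebraMap K _ (augmentation K g u)) ∈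
      Submodule.span (UEA K g) S.negRootVectors := by
  set A := Submodule.span (UEA K g) S.negRootVectors
  let B : Subalgebra K (UEA K g) :=
    { carrier := {u | (S.vIdeal 0).mkQ (u - algebraMap K _ (augmentation K g u)) ∈ A}
      mul_mem' := fun {a b} ha hb => by
        have h₁ : a * b - algebraMap K _ (augmentation K g (a * b)) =
            a • (b - algebraMap K _ (augmentation K g b)) +
              algebraMap K (UEA K g) (augmentation K g b) •
                (a - algebraMap K _ (augmentation K g a)) := by
          have h₂ : algebraMap K (UEA K g) (augmentation K g (a * b)) =
              algebraMap K (UEA K g) (augmentation K g b) *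
                algebraMap K (UEA K g) (augmentation K g a) := by
            rw [← map_mul, map_mul, mul_comm]
          rw [h₂, smul_eq_mul, smul_eq_mul, mul_sub, mul_sub,
            Algebra.commutes (augmentation K g b) a]
          abel
        rw [Set.mem_ofPred_eq, h₁, map_add, map_smul, map_smul]
        exact A.add_mem (A.smul_mem _ hb) (A.smul_mem _ ha)
      add_mem' := fun {a b} ha hb => by
        rw [Set.mem_ofPred_eq, map_add, map_add, add_sub_add_comm, map_add]
        exact A.add_mem ha hb
      algebraMap_mem' := fun c => by
        rw [Set.mem_ofPred_eq, AlgHom.commutes, Algebra.algebraMap_self, RingHom.id_apply, sub_self,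
          map_zero]
        exact A.zero_mem }
  refine UniversalEnvelopingAlgebra.mem_of_forall_mem_of_subalgebra B (fun x => ?_) u
  show (S.vIdeal 0).mkQ (ι K x - algebraMap K _ (augmentation K g (ι K x))) ∈ A
  rw [augmentation, lift_ι_apply, LieHom.zero_apply, map_zero, sub_zero]
  exact mkQ_ι_mem_span x

theorem smul_trivMod (u : UEA K g) (c : TrivMod K) :
    u • c = (augmentation K g u * (show K from c) : K) := rfl

theorem ker_eq_span (π : S.Verma 0 →ₗ[UEA K g] TrivMod K) (hπ : Function.Surjective π) :
    LinearMap.ker π = Submodule.span (UEA K g) S.negRootVectors := by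
  have hmk (u : UEA K g) : (S.vIdeal 0).mkQ u = u • (S.vIdeal 0).mkQ 1 := by
    rw [← map_smul, smul_eq_mul, mul_one]
  have hle : Submodule.span (UEA K g) S.negRootVectors ≤ LinearMap.ker π := by
    rw [Submodule.span_le]
    rintro _ ⟨α, -, x, -, rfl⟩
    rw [SetLike.mem_coe, LinearMap.mem_ker, hmk, map_smul, smul_trivMod, augmentation,
      lift_ι_apply, LieHom.zero_apply, zero_mul]
    rfl
  have h1 : π ((S.vIdeal 0).mkQ 1) ≠ 0 := by
    intro h0
    obtain ⟨m, hm⟩ := hπ (show TrivMod K from (1 : K))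
    obtain ⟨u, rfl⟩ := (S.vIdeal 0).mkQ_surjective m
    rw [hmk, map_smul, h0, smul_zero] at hm
    exact one_ne_zero (α := K) hm.symm
  refine le_antisymm (fun m hm => ?_) hle
  obtain ⟨u, rfl⟩ := (S.vIdeal 0).mkQ_surjective m
  have h₁ := mkQ_sub_mem_span (S := S) u
  have h₂ := hle h₁
  rw [LinearMap.mem_ker] at hm h₂
  rw [map_sub, map_sub, hm, zero_sub, neg_eq_zero, hmk, map_smul, smul_trivMod,
    AlgHom.commutes] at h₂
  have h₃ : augmentation K g u = 0 := (mul_eq_zero.mp h₂).resolve_right h1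
  rwa [h₃, map_zero, sub_zero] at h₁

theorem finite_roots_of_fg (hD : S.IsDynkin)
    (h : (Submodule.span (UEA K g) S.negRootVectors).FG) : S.Φ.Finite := by
  classical
  obtain ⟨T, hT, hTspan⟩ := (Submodule.fg_span_iff_fg_span_finset_subset _).mp h
  have hT' : ∀ m ∈ T, ∃ α x, α ∈ S.Φp ∧ x ∈ rootSp K g S.h (-α) ∧
      m = (S.vIdeal 0).mkQ (ι K x) := by
    intro m hm
    obtain ⟨α, hα, x, hx, rfl⟩ := hT hm
    exact ⟨α, x, hα, hx, rfl⟩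
  choose! α x hα hx hm using hT'
  refine finite_roots hD (T.image α) (by simpa using fun m hm => hα m hm) fun δ hδ => ?_
  set Q := AddSubmonoid.closure (S.Φp ∪ {β | -β ∈ T.image α}) with hQ
  set p := S.weightSubalgebra Q with hp
  set J := Submodule.span (UEA K g) (ι K '' (p : Set g)) with hJ
  have hvJ : S.vIdeal 0 ≤ J := by
    rw [vIdeal, Submodule.span_le]
    rintro _ (⟨y, hy, rfl⟩ | ⟨H, rfl⟩)
    · refine Submodule.subset_span ⟨y, ?_, rfl⟩
      have h₁ : S.nplus ≤ p.toSubmodule := iSup₂_le fun β hβ y hy =>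
        mem_weightSubalgebra (AddSubmonoid.subset_closure (Or.inl hβ)) hy
      exact h₁ hy
    · rw [LinearMap.zero_apply, map_zero, sub_zero]
      exact Submodule.subset_span
        ⟨H, mem_weightSubalgebra Q.zero_mem (mem_rootSp_zero.mpr H.2), rfl⟩
  obtain ⟨f, hf, hf0⟩ := exists_ne_zero (neg_mem (S.pos_subset hδ))
  have hfJ : ι K f ∈ J := by
    have h₁ : (S.vIdeal 0).mkQ (ι K f) ∈ J.map (S.vIdeal 0).mkQ := by
      have h₂ : Submodule.span (UEA K g) (T : Set (S.Verma 0)) ≤ J.map (S.vIdeal 0).mkQ := by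
        rw [Submodule.span_le]
        intro m hmT
        rw [hm m hmT]
        refine ⟨_, Submodule.subset_span ⟨x m, mem_weightSubalgebra
          (AddSubmonoid.subset_closure (Or.inr ?_)) (hx m hmT), rfl⟩, rfl⟩
        rw [Set.mem_ofPred_eq, neg_neg]
        exact Finset.mem_image_of_mem α hmT
      rw [← hTspan] at h₂
      exact h₂ (mkQ_ι_mem_span f)
    obtain ⟨j, hj, hjf⟩ := h₁
    rw [Submodule.mkQ_apply, Submodule.mkQ_apply, Submodule.Quotient.eq] at hjf
    have := J.sub_mem hj (hvJ hjf)
    rwa [sub_sub_cancel] at this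
  obtain ⟨H, hH⟩ : ∃ H, δ H ≠ 0 := by
    by_contra! h
    exact ((S.root_iff δ).mp (S.pos_subset hδ)).1 (LinearMap.ext h)
  obtain ⟨n, hn, hfn, hHn⟩ := ((eventually_normalizes_of_mem_span S.gc_mono S.gc_exhausts
    S.gc_findim p hfJ).and ((eventually_mem S.gc_mono S.gc_exhausts f).and
      (eventually_mem S.gc_mono S.gc_exhausts (H : g)))).exists
  have hfp := hn hfn H hHn (mem_weightSubalgebra Q.zero_mem (mem_rootSp_zero.mpr H.2))
  rw [← lie_skew, hf H, LinearMap.neg_apply, neg_smul, neg_neg] at hfp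
  exact mem_of_mem_weightSubalgebra hf hf0 (((p.toSubmodule).smul_mem_iff hH).mp hfp)

end RootReductive

/-- if `[g,g]` is infinite dimensional, the radical of `Δ(0)`, i.e. the
kernel of the canonical surjection `Δ(0) ↠ k`, is not a finitely generated
`U(g)`-module. -/
theorem radical_verma_zero_not_fg (S : RootReductive K g) (hD : S.IsDynkin)
    (hinf : ¬ FiniteDimensional K (LieAlgebra.derivedSeries K g 1))
    (π : (S.Verma 0) →ₗ[UEA K g] TrivMod K) (hπ : Function.Surjective π) :
    ¬ (LinearMap.ker π).FG := by
  intro h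
  rw [RootReductive.ker_eq_span π hπ] at h
  exact hinf (RootReductive.finiteDimensional_derived (RootReductive.finite_roots_of_fg hD h))
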